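/- Let V = V_1 ⊕ V_2 ⊕ V_3 and R = O(V)^{SL(2,ℂ)}. Then R has a homogeneous system of parameters consisting of six invariants, of degrees 3, 3, 4, 4, 4, 5, and the minimal number of algebra generators of R equals 15 (with 1 generator of degree 2, 3 of degree 3, 4 of degree 4, 4 of degree 5, 2 of degree 6, and 1 of degree 7). Moreover, R has no homogeneous system of parameters with degrees 2, 3, 3, 4, 4, 5. -/

import Mathlib

open MvPolynomial

noncomputable section

namespace BinInv

/-- `k`-fold partial derivative with respect to the variable `v`. -/
def pd {A : Type*} [CommSemiring A] (v : Fin 2) (k : ℕ)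
    (f : MvPolynomial (Fin 2) A) : MvPolynomial (Fin 2) A :=
  (fun g => MvPolynomial.pderiv v g)^[k] f

/-- The `p`-th transvectant of binary forms `g`, `h` of degrees `m`, `n`,
with coefficients in a commutative `ℂ`-algebra `A`. -/
def transvectant {A : Type*} [CommRing A] [Algebra ℂ A] (m n p : ℕ)
    (g h : MvPolynomial (Fin 2) A) : MvPolynomial (Fin 2) A :=
  algebraMap ℂ (MvPolynomial (Fin 2) A)
      ((((m - p).factorial * (n - p).factorial : ℕ) : ℂ) /
        (((m.factorial * n.factorial : ℕ)) : ℂ)) *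
    ∑ i ∈ Finset.range (p + 1),
      algebraMap ℂ (MvPolynomial (Fin 2) A) ((-1 : ℂ) ^ i * (p.choose i : ℂ)) *
        (pd 0 (p - i) (pd 1 i g) * pd 0 i (pd 1 (p - i) h))

variable {p : ℕ}

/-- Index type for the coefficients of a system of binary forms of degrees `n 0, …, n (p-1)`:
the space `V = V_{n 0} ⊕ … ⊕ V_{n (p-1)}` is identified with `Idx n → ℂ`. -/
abbrev Idx (n : Fin p → ℕ) : Type := Σ i : Fin p, Fin (n i + 1)

/-- The binary form of degree `n i` with coefficient vector `c`. -/
def formAt (n : Fin p → ℕ) (c : Idx n → ℂ) (i : Fin p) : MvPolynomial (Fin 2) ℂ :=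
  ∑ k : Fin (n i + 1), C (c ⟨i, k⟩) * X 0 ^ (n i - (k : ℕ)) * X 1 ^ (k : ℕ)

/-- The substitution action of `SL(2,ℂ)` on binary forms: `(g • f)(v) = f (g⁻¹ • v)`. -/
def sl2Act (g : Matrix.SpecialLinearGroup (Fin 2) ℂ) (f : MvPolynomial (Fin 2) ℂ) :
    MvPolynomial (Fin 2) ℂ :=
  aeval (fun i => ∑ j, C ((↑(g⁻¹) : Matrix (Fin 2) (Fin 2) ℂ) i j) * X j) f

/-- The coefficient of `x^(n-k) y^k` in a binary form. -/
def coeffAt (n : Fin p → ℕ) (j : Idx n) (f : MvPolynomial (Fin 2) ℂ) : ℂ :=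
  MvPolynomial.coeff
    (Finsupp.single 0 (n j.1 - (j.2 : ℕ)) + Finsupp.single 1 (j.2 : ℕ)) f

/-- The induced action of `SL(2,ℂ)` on points of `V`, in coefficient coordinates. -/
def actPt (n : Fin p → ℕ) (g : Matrix.SpecialLinearGroup (Fin 2) ℂ) (c : Idx n → ℂ) :
    Idx n → ℂ :=
  fun j => coeffAt n j (sl2Act g (formAt n c j.1))

/-- A polynomial function on `V` is invariant if it is constant on `SL(2,ℂ)`-orbits. -/
def IsInvariant (n : Fin p → ℕ) (P : MvPolynomial (Idx n) ℂ) : Prop :=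
  ∀ (g : Matrix.SpecialLinearGroup (Fin 2) ℂ) (c : Idx n → ℂ),
    eval (actPt n g c) P = eval c P

/-- The invariant ring `R = O(V)^{SL(2,ℂ)}` as a subalgebra of `O(V)`. -/
def invariantRing (n : Fin p → ℕ) : Subalgebra ℂ (MvPolynomial (Idx n) ℂ) where
  carrier := {P | IsInvariant n P}
  mul_mem' := fun ha hb g c => by
    simp only [map_mul]; rw [ha g c, hb g c]
  one_mem' := fun g c => by simp
  add_mem' := fun ha hb g c => by
    simp only [map_add]; rw [ha g c, hb g c]
  zero_mem' := fun g c => by simp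
  algebraMap_mem' := fun r g c => by simp

/-- The nullcone: the points of `V` where every homogeneous invariant of positive
degree vanishes. -/
def Nullcone (n : Fin p → ℕ) : Set (Idx n → ℂ) :=
  {c | ∀ P ∈ invariantRing n, ∀ d : ℕ, 0 < d → P.IsHomogeneous d → eval c P = 0}

/-- `P` is a homogeneous system of parameters of the invariant ring, with degrees `d`:
the `P j` are homogeneous invariants of positive degrees `d j`, algebraically independent
over `ℂ`, and the invariant ring is integral over the subalgebra they generate. -/
def IsHSOP (n : Fin p → ℕ) {k : ℕ} (P : Fin k → MvPolynomial (Idx n) ℂ)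
    (d : Fin k → ℕ) : Prop :=
  (∀ j, P j ∈ invariantRing n) ∧ (∀ j, 0 < d j) ∧
    (∀ j, (P j).IsHomogeneous (d j)) ∧ AlgebraicIndependent ℂ P ∧
    ∀ x ∈ invariantRing n, IsIntegral (↥(Algebra.adjoin ℂ (Set.range P))) x

/-- `r` is the minimal number of generators of the invariant ring. -/
def IsMinimalNumGens (n : Fin p → ℕ) (r : ℕ) : Prop :=
  IsLeast {k | ∃ S : Finset (MvPolynomial (Idx n) ℂ),
    S.card = k ∧ Algebra.adjoin ℂ (S : Set (MvPolynomial (Idx n) ℂ)) = invariantRing n} r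

/-- The invariant ring has minimal number of generators `r`, realized by a minimal
system of homogeneous generators of degrees `d 0, …, d (r-1)`. -/
def HasMinimalGens (n : Fin p → ℕ) {r : ℕ} (d : Fin r → ℕ) : Prop :=
  IsMinimalNumGens n r ∧
    ∃ G : Fin r → MvPolynomial (Idx n) ℂ, Function.Injective G ∧
      (∀ j, (G j).IsHomogeneous (d j)) ∧
      Algebra.adjoin ℂ (Set.range G) = invariantRing n

/-- The generic binary form of degree `n i`, whose coefficients are the corresponding
coordinate functions on `V`. -/
def genForm (n : Fin p → ℕ) (i : Fin p) :
    MvPolynomial (Fin 2) (MvPolynomial (Idx n) ℂ) :=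
  ∑ k : Fin (n i + 1), C (X ⟨i, k⟩) * X 0 ^ (n i - (k : ℕ)) * X 1 ^ (k : ℕ)

end BinInv

end

namespace BinInv

section Tuples

variable {K : Type*}

/-- The family on `Idx ![1, 2, 3]` with the given nine entries. -/
def tup (l₀ l₁ a₀ a₁ a₂ b₀ b₁ b₂ b₃ : K) : Idx ![1, 2, 3] → K
  | ⟨0, k⟩ => (![l₀, l₁] : Fin 2 → K) k
  | ⟨1, k⟩ => (![a₀, a₁, a₂] : Fin 3 → K) k
  | ⟨2, k⟩ => (![b₀, b₁, b₂, b₃] : Fin 4 → K) k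

theorem forall_idx {p : Idx ![1, 2, 3] → Prop} :
    (∀ j, p j) ↔ p ⟨0, (0 : Fin 2)⟩ ∧ p ⟨0, (1 : Fin 2)⟩ ∧ p ⟨1, (0 : Fin 3)⟩ ∧
      p ⟨1, (1 : Fin 3)⟩ ∧ p ⟨1, (2 : Fin 3)⟩ ∧ p ⟨2, (0 : Fin 4)⟩ ∧ p ⟨2, (1 : Fin 4)⟩ ∧
      p ⟨2, (2 : Fin 4)⟩ ∧ p ⟨2, (3 : Fin 4)⟩ := by
  constructor
  · intro h
    exact ⟨h _, h _, h _, h _, h _, h _, h _, h _, h _⟩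
  · rintro ⟨h0, h1, h2, h3, h4, h5, h6, h7, h8⟩ ⟨i, k⟩
    match i, k with
    | 0, (0 : Fin 2) => exact h0
    | 0, (1 : Fin 2) => exact h1
    | 1, (0 : Fin 3) => exact h2
    | 1, (1 : Fin 3) => exact h3
    | 1, (2 : Fin 3) => exact h4
    | 2, (0 : Fin 4) => exact h5
    | 2, (1 : Fin 4) => exact h6
    | 2, (2 : Fin 4) => exact h7
    | 2, (3 : Fin 4) => exact h8

theorem eq_tup (c : Idx ![1, 2, 3] → K) :
    c = tup (c ⟨0, (0 : Fin 2)⟩) (c ⟨0, (1 : Fin 2)⟩) (c ⟨1, (0 : Fin 3)⟩) (c ⟨1, (1 : Fin 3)⟩)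
      (c ⟨1, (2 : Fin 3)⟩) (c ⟨2, (0 : Fin 4)⟩) (c ⟨2, (1 : Fin 4)⟩) (c ⟨2, (2 : Fin 4)⟩)
      (c ⟨2, (3 : Fin 4)⟩) := by
  rw [funext_iff, forall_idx]
  exact ⟨rfl, rfl, rfl, rfl, rfl, rfl, rfl, rfl, rfl⟩

theorem exists_eq_tup (c : Idx ![1, 2, 3] → K) :
    ∃ l₀ l₁ a₀ a₁ a₂ b₀ b₁ b₂ b₃, c = tup l₀ l₁ a₀ a₁ a₂ b₀ b₁ b₂ b₃ :=
  ⟨_, _, _, _, _, _, _, _, _, eq_tup c⟩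

theorem comp_tup {L : Type*} (φ : K → L) (l₀ l₁ a₀ a₁ a₂ b₀ b₁ b₂ b₃ : K) :
    (fun j => φ (tup l₀ l₁ a₀ a₁ a₂ b₀ b₁ b₂ b₃ j)) =
      tup (φ l₀) (φ l₁) (φ a₀) (φ a₁) (φ a₂) (φ b₀) (φ b₁) (φ b₂) (φ b₃) := by
  rw [funext_iff, forall_idx]
  exact ⟨rfl, rfl, rfl, rfl, rfl, rfl, rfl, rfl, rfl⟩

end Tuples

section Covariants

variable {K : Type*} [CommRing K]

/-- Value of a binary quadratic form. -/
def qe (a₀ a₁ a₂ x y : K) : K := a₀ * x ^ 2 + a₁ * x * y + a₂ * y ^ 2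

/-- Polar bilinear form of a binary quadratic form. -/
def qb (a₀ a₁ a₂ x y z w : K) : K := 2 * a₀ * x * z + a₁ * (x * w + y * z) + 2 * a₂ * y * w

/-- Value of a binary cubic form. -/
def ce (b₀ b₁ b₂ b₃ x y : K) : K := b₀ * x ^ 3 + b₁ * x ^ 2 * y + b₂ * x * y ^ 2 + b₃ * y ^ 3

/-- Directional derivative along `(z, w)` of a binary cubic form. -/
def cp (b₀ b₁ b₂ b₃ x y z w : K) : K :=
  (3 * b₀ * x ^ 2 + 2 * b₁ * x * y + b₂ * y ^ 2) * z +
    (b₁ * x ^ 2 + 2 * b₂ * x * y + 3 * b₃ * y ^ 2) * w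

/-- First coefficient of the Hessian of a binary cubic. -/
def hes₀ (b₀ b₁ b₂ : K) : K := 3 * b₀ * b₂ - b₁ ^ 2
/-- Middle coefficient of the Hessian of a binary cubic. -/
def hes₁ (b₀ b₁ b₂ b₃ : K) : K := 9 * b₀ * b₃ - b₁ * b₂
/-- Last coefficient of the Hessian of a binary cubic. -/
def hes₂ (b₁ b₂ b₃ : K) : K := 3 * b₁ * b₃ - b₂ ^ 2

/-- First coefficient of the second transvectant of a quadratic and a cubic. -/
def lin₀ (a₀ a₁ a₂ b₀ b₁ b₂ : K) : K := a₀ * b₂ - a₁ * b₁ + 3 * a₂ * b₀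
/-- Second coefficient of the second transvectant of a quadratic and a cubic. -/
def lin₁ (a₀ a₁ a₂ b₁ b₂ b₃ : K) : K := 3 * a₀ * b₃ - a₁ * b₂ + a₂ * b₁

/-- The fifteen basic invariants in terms of the root `v` of the linear form, the quadratic `a`,
the cubic `b`, its Hessian `h` and the root `u` of the second transvectant of `a` and `b`. -/
def gensOf (v₀ v₁ a₀ a₁ a₂ b₀ b₁ b₂ b₃ h₀ h₁ h₂ u₀ u₁ : K) : Fin 15 → K :=
  ![a₁ ^ 2 - 4 * a₀ * a₂,
    qe a₀ a₁ a₂ v₀ v₁,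
    u₀ * v₁ - u₁ * v₀,
    2 * a₀ * h₂ - a₁ * h₁ + 2 * a₂ * h₀,
    ce b₀ b₁ b₂ b₃ v₀ v₁,
    qe h₀ h₁ h₂ v₀ v₁,
    qb a₀ a₁ a₂ v₀ v₁ u₀ u₁,
    h₁ ^ 2 - 4 * h₀ * h₂,
    qb a₀ a₁ a₂ v₀ v₁ (cp b₀ b₁ b₂ b₃ v₀ v₁ 0 1) (-cp b₀ b₁ b₂ b₃ v₀ v₁ 1 0),
    qb a₀ a₁ a₂ v₀ v₁ (qb h₀ h₁ h₂ v₀ v₁ 0 1) (-qb h₀ h₁ h₂ v₀ v₁ 1 0),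
    qb h₀ h₁ h₂ v₀ v₁ u₀ u₁,
    qe a₀ a₁ a₂ u₀ u₁,
    cp b₀ b₁ b₂ b₃ v₀ v₁ (qb h₀ h₁ h₂ v₀ v₁ 0 1) (-qb h₀ h₁ h₂ v₀ v₁ 1 0),
    qb a₀ a₁ a₂ v₀ v₁ (qb h₀ h₁ h₂ u₀ u₁ 0 1) (-qb h₀ h₁ h₂ u₀ u₁ 1 0),
    qb a₀ a₁ a₂ u₀ u₁ (qb h₀ h₁ h₂ u₀ u₁ 0 1) (-qb h₀ h₁ h₂ u₀ u₁ 1 0)]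

/-- The fifteen basic invariants of a linear, a quadratic and a cubic form. -/
def gens (l₀ l₁ a₀ a₁ a₂ b₀ b₁ b₂ b₃ : K) : Fin 15 → K :=
  gensOf l₁ (-l₀) a₀ a₁ a₂ b₀ b₁ b₂ b₃ (hes₀ b₀ b₁ b₂) (hes₁ b₀ b₁ b₂ b₃) (hes₂ b₁ b₂ b₃)
    (lin₁ a₀ a₁ a₂ b₁ b₂ b₃) (-lin₀ a₀ a₁ a₂ b₀ b₁ b₂)

/-- The fifteen basic invariants evaluated on a family of nine elements. -/
def genFam (c : Idx ![1, 2, 3] → K) : Fin 15 → K :=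
  gens (c ⟨0, (0 : Fin 2)⟩) (c ⟨0, (1 : Fin 2)⟩) (c ⟨1, (0 : Fin 3)⟩) (c ⟨1, (1 : Fin 3)⟩)
      (c ⟨1, (2 : Fin 3)⟩) (c ⟨2, (0 : Fin 4)⟩) (c ⟨2, (1 : Fin 4)⟩) (c ⟨2, (2 : Fin 4)⟩)
      (c ⟨2, (3 : Fin 4)⟩)

theorem genFam_tup (l₀ l₁ a₀ a₁ a₂ b₀ b₁ b₂ b₃ : K) :
    genFam (tup l₀ l₁ a₀ a₁ a₂ b₀ b₁ b₂ b₃) = gens l₀ l₁ a₀ a₁ a₂ b₀ b₁ b₂ b₃ := rfl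

theorem map_gens {L : Type*} [CommRing L] (φ : K →+* L) (l₀ l₁ a₀ a₁ a₂ b₀ b₁ b₂ b₃ : K)
    (j : Fin 15) : φ (gens l₀ l₁ a₀ a₁ a₂ b₀ b₁ b₂ b₃ j) =
      gens (φ l₀) (φ l₁) (φ a₀) (φ a₁) (φ a₂) (φ b₀) (φ b₁) (φ b₂) (φ b₃) j := by
  fin_cases j <;>
  simp only [gens, gensOf, Fin.reduceFinMk, Matrix.cons_val, qe, qb, ce, cp, hes₀, hes₁, hes₂,
    lin₀, lin₁, map_add, map_sub, map_mul, map_pow, map_neg, map_ofNat, map_zero, map_one]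

/-- Substitution `x ↦ p x + q y`, `y ↦ r x + s y` on coefficients. -/
def act (p q r s : K) (c : Idx ![1, 2, 3] → K) : Idx ![1, 2, 3] → K :=
  let l₀ := c ⟨0, (0 : Fin 2)⟩
  let l₁ := c ⟨0, (1 : Fin 2)⟩
  let a₀ := c ⟨1, (0 : Fin 3)⟩
  let a₁ := c ⟨1, (1 : Fin 3)⟩
  let a₂ := c ⟨1, (2 : Fin 3)⟩
  let b₀ := c ⟨2, (0 : Fin 4)⟩
  let b₁ := c ⟨2, (1 : Fin 4)⟩
  let b₂ := c ⟨2, (2 : Fin 4)⟩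
  let b₃ := c ⟨2, (3 : Fin 4)⟩
  tup (p * l₀ + r * l₁) (q * l₀ + s * l₁) (qe a₀ a₁ a₂ p r) (qb a₀ a₁ a₂ p r q s)
    (qe a₀ a₁ a₂ q s) (ce b₀ b₁ b₂ b₃ p r) (cp b₀ b₁ b₂ b₃ p r q s) (cp b₀ b₁ b₂ b₃ q s p r)
    (ce b₀ b₁ b₂ b₃ q s)

theorem gensOf_act {p q r s : K} (hd : p * s - q * r = 1)
    (v₀ v₁ a₀ a₁ a₂ b₀ b₁ b₂ b₃ h₀ h₁ h₂ u₀ u₁ : K) :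
    gensOf (s * v₀ - q * v₁) (p * v₁ - r * v₀) (qe a₀ a₁ a₂ p r) (qb a₀ a₁ a₂ p r q s)
      (qe a₀ a₁ a₂ q s) (ce b₀ b₁ b₂ b₃ p r) (cp b₀ b₁ b₂ b₃ p r q s) (cp b₀ b₁ b₂ b₃ q s p r)
      (ce b₀ b₁ b₂ b₃ q s) (qe h₀ h₁ h₂ p r) (qb h₀ h₁ h₂ p r q s)
      (qe h₀ h₁ h₂ q s) (s * u₀ - q * u₁) (p * u₁ - r * u₀) =
    gensOf v₀ v₁ a₀ a₁ a₂ b₀ b₁ b₂ b₃ h₀ h₁ h₂ u₀ u₁ := by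
  have key : ∀ (k : ℕ) {x y : K}, x = (p * s - q * r) ^ k * y → x = y := by
    rintro k x y rfl
    rw [hd, one_pow, one_mul]
  funext j
  fin_cases j <;>
  simp only [gensOf, Fin.reduceFinMk, Matrix.cons_val]
  · exact key 2 (by simp only [qe, qb]; ring)
  · exact key 2 (by simp only [qe, qb]; ring)
  · exact key 1 (by ring)
  · exact key 2 (by simp only [qe, qb]; ring)
  · exact key 3 (by simp only [ce, cp]; ring)
  · exact key 2 (by simp only [qe, qb]; ring)
  · exact key 2 (by simp only [qe, qb]; ring)
  · exact key 2 (by simp only [qe, qb]; ring)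
  · exact key 4 (by simp only [qe, qb, ce, cp]; ring)
  · exact key 3 (by simp only [qb, qe]; ring)
  · exact key 2 (by simp only [qe, qb]; ring)
  · exact key 2 (by simp only [qe, qb]; ring)
  · exact key 4 (by simp only [qe, qb, ce, cp]; ring)
  · exact key 3 (by simp only [qe, qb]; ring)
  · exact key 3 (by simp only [qe, qb]; ring)

theorem genFam_act {p q r s : K} (hd : p * s - q * r = 1) (c : Idx ![1, 2, 3] → K) :
    genFam (act p q r s c) = genFam c := by
  have key : ∀ (k : ℕ) {x y : K}, x = (p * s - q * r) ^ k * y → x = y := by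
    rintro k x y rfl
    rw [hd, one_pow, one_mul]
  obtain ⟨l₀, l₁, a₀, a₁, a₂, b₀, b₁, b₂, b₃, rfl⟩ := exists_eq_tup c
  change gens (p * l₀ + r * l₁) (q * l₀ + s * l₁) (qe a₀ a₁ a₂ p r) (qb a₀ a₁ a₂ p r q s)
    (qe a₀ a₁ a₂ q s) (ce b₀ b₁ b₂ b₃ p r) (cp b₀ b₁ b₂ b₃ p r q s) (cp b₀ b₁ b₂ b₃ q s p r)
    (ce b₀ b₁ b₂ b₃ q s) = gens l₀ l₁ a₀ a₁ a₂ b₀ b₁ b₂ b₃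
  refine Eq.trans ?_ (gensOf_act hd _ _ _ _ _ _ _ _ _ _ _ _ _ _)
  rw [gens]
  congr 1
  · ring
  · ring
  · exact key 2 (by simp only [qe, ce, cp, hes₀, hes₁, hes₂]; ring)
  · exact key 2 (by simp only [qb, ce, cp, hes₀, hes₁, hes₂]; ring)
  · exact key 2 (by simp only [qe, ce, cp, hes₀, hes₁, hes₂]; ring)
  · exact key 2 (by simp only [qe, qb, ce, cp, lin₀, lin₁]; ring)
  · exact key 2 (by simp only [qe, qb, ce, cp, lin₀, lin₁]; ring)

end Covariants

theorem coeffAt_formAt {p : ℕ} (n : Fin p → ℕ) (c : Idx n → ℂ) (j : Idx n) :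
    coeffAt n j (formAt n c j.1) = c j := by
  obtain ⟨i, k⟩ := j
  have h : ∀ m : Fin (n i + 1), C (c ⟨i, m⟩) * X 0 ^ (n i - (m : ℕ)) * X 1 ^ (m : ℕ) =
      monomial (Finsupp.single (0 : Fin 2) (n i - (m : ℕ)) + Finsupp.single 1 (m : ℕ))
        (c ⟨i, m⟩) := by
    intro m
    rw [X_pow_eq_monomial, X_pow_eq_monomial, C_mul_monomial, monomial_mul, mul_one, mul_one]
  simp only [coeffAt, formAt, h, coeff_sum, coeff_monomial]
  rw [Finset.sum_eq_single k]
  · simp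
  · intro m _ hm
    rw [if_neg]
    intro he
    apply hm
    have := DFunLike.congr_fun he 1
    simpa [Fin.ext_iff] using this
  · simp

theorem formAt_zero (c : Idx ![1, 2, 3] → ℂ) : formAt ![1, 2, 3] c 0 =
    C (c ⟨0, (0 : Fin 2)⟩) * X 0 + C (c ⟨0, (1 : Fin 2)⟩) * X 1 := by
  refine (Fin.sum_univ_two (M := MvPolynomial (Fin 2) ℂ) _).trans ?_
  simp

theorem formAt_one (c : Idx ![1, 2, 3] → ℂ) : formAt ![1, 2, 3] c 1 =
    C (c ⟨1, (0 : Fin 3)⟩) * X 0 ^ 2 + C (c ⟨1, (1 : Fin 3)⟩) * X 0 * X 1 +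
      C (c ⟨1, (2 : Fin 3)⟩) * X 1 ^ 2 := by
  refine (Fin.sum_univ_three (M := MvPolynomial (Fin 2) ℂ) _).trans ?_
  simp

theorem formAt_two (c : Idx ![1, 2, 3] → ℂ) : formAt ![1, 2, 3] c 2 =
    C (c ⟨2, (0 : Fin 4)⟩) * X 0 ^ 3 + C (c ⟨2, (1 : Fin 4)⟩) * X 0 ^ 2 * X 1 +
      C (c ⟨2, (2 : Fin 4)⟩) * X 0 * X 1 ^ 2 + C (c ⟨2, (3 : Fin 4)⟩) * X 1 ^ 3 := by
  refine (Fin.sum_univ_four (M := MvPolynomial (Fin 2) ℂ) _).trans ?_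
  simp

theorem sl2Act_formAt (g : Matrix.SpecialLinearGroup (Fin 2) ℂ) (c : Idx ![1, 2, 3] → ℂ)
    (i : Fin 3) :
    sl2Act g (formAt ![1, 2, 3] c i) = formAt ![1, 2, 3]
      (act ((g⁻¹).1 0 0) ((g⁻¹).1 0 1) ((g⁻¹).1 1 0) ((g⁻¹).1 1 1) c) i := by
  obtain ⟨l₀, l₁, a₀, a₁, a₂, b₀, b₁, b₂, b₃, rfl⟩ := exists_eq_tup c
  have hX : ∀ i, aeval (fun i => ∑ j, C ((↑(g⁻¹) : Matrix (Fin 2) (Fin 2) ℂ) i j) * X j)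
      (X i : MvPolynomial (Fin 2) ℂ) =
      C ((g⁻¹).1 i 0) * X 0 + C ((g⁻¹).1 i 1) * X 1 := by
    intro i
    rw [aeval_X, Fin.sum_univ_two]
  have hC : ∀ a : ℂ, aeval (fun i => ∑ j, C ((↑(g⁻¹) : Matrix (Fin 2) (Fin 2) ℂ) i j) * X j)
      (C a : MvPolynomial (Fin 2) ℂ) = C a := fun a => aeval_C _ a
  fin_cases i
  · simp only [sl2Act, Fin.zero_eta, formAt_zero, map_add, map_mul, hX, hC]
    simp only [act, tup, Matrix.cons_val, map_add, map_mul]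
    ring
  · simp only [sl2Act, Fin.mk_one, formAt_one, map_add, map_mul, map_pow, hX, hC]
    simp only [act, tup, qe, qb, Matrix.cons_val, map_add, map_mul, map_pow, map_ofNat]
    ring
  · simp only [sl2Act, Fin.reduceFinMk, formAt_two, map_add, map_mul, map_pow, hX, hC]
    simp only [act, tup, ce, cp, Matrix.cons_val, map_add, map_mul, map_pow, map_ofNat]
    ring

theorem actPt_eq (g : Matrix.SpecialLinearGroup (Fin 2) ℂ) (c : Idx ![1, 2, 3] → ℂ) :
    actPt ![1, 2, 3] g c =
      act ((g⁻¹).1 0 0) ((g⁻¹).1 0 1) ((g⁻¹).1 1 0) ((g⁻¹).1 1 1) c := by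
  funext j
  rw [actPt, sl2Act_formAt, coeffAt_formAt]

theorem eval_act {P : MvPolynomial (Idx ![1, 2, 3]) ℂ} (hP : P ∈ invariantRing ![1, 2, 3])
    {p q r s : ℂ} (hd : p * s - q * r = 1) (c : Idx ![1, 2, 3] → ℂ) :
    eval (act p q r s c) P = eval c P := by
  let h : Matrix.SpecialLinearGroup (Fin 2) ℂ :=
    ⟨!![p, q; r, s], by rw [Matrix.det_fin_two_of]; exact hd⟩
  have := hP h⁻¹ c
  rwa [actPt_eq, inv_inv] at this

/-- The ring of polynomial functions on the space of triples of a linear, a quadratic and a cubic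
form. -/
abbrev Pol : Type := MvPolynomial (Idx ![1, 2, 3]) ℂ

/-- The fifteen basic invariants as polynomials in the coefficients. -/
noncomputable def G : Fin 15 → Pol := genFam X

theorem map_genFam {K L : Type*} [CommRing K] [CommRing L] (φ : K →+* L)
    (c : Idx ![1, 2, 3] → K) (j : Fin 15) : φ (genFam c j) = genFam (fun i => φ (c i)) j :=
  map_gens φ _ _ _ _ _ _ _ _ _ j

theorem eval_G (c : Idx ![1, 2, 3] → ℂ) (j : Fin 15) : eval c (G j) = genFam c j := by
  rw [G, map_genFam]
  simp only [eval_X]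

theorem aeval_G {A : Type*} [CommRing A] [Algebra ℂ A] (c : Idx ![1, 2, 3] → A) (j : Fin 15) :
    aeval c (G j) = genFam c j := by
  rw [G]
  refine (map_genFam (aeval c : Pol →ₐ[ℂ] A).toRingHom X j).trans ?_
  congr 1
  funext i
  exact aeval_X c i

theorem G_mem (j : Fin 15) : G j ∈ invariantRing ![1, 2, 3] := by
  intro g c
  rw [eval_G, eval_G, actPt_eq, genFam_act]
  have := (g⁻¹).2
  rwa [Matrix.det_fin_two] at this

/-- The algebra generated by the fifteen basic invariants. -/
noncomputable def genAlg : Subalgebra ℂ Pol := Algebra.adjoin ℂ (Set.range G)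

theorem G_mem_genAlg (j : Fin 15) : G j ∈ genAlg := Algebra.subset_adjoin ⟨j, rfl⟩

theorem genAlg_le : genAlg ≤ invariantRing ![1, 2, 3] :=
  Algebra.adjoin_le (by rintro _ ⟨j, rfl⟩; exact G_mem j)

/-- The degrees of the basic invariants. -/
def gdeg : Fin 15 → ℕ := ![2, 3, 3, 3, 4, 4, 4, 4, 5, 5, 5, 5, 6, 6, 7]

section Grading

variable {σ : Type*}

/-- Restriction of a polynomial to the weighted curve `t ↦ (t ^ w i * c i)ᵢ`. -/
noncomputable def onCurve (w : σ → ℕ) (c : σ → ℂ) : MvPolynomial σ ℂ →ₐ[ℂ] Polynomial ℂ :=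
  aeval (fun i => Polynomial.monomial (w i) (c i))

theorem eval_onCurve (w : σ → ℕ) (c : σ → ℂ) (P : MvPolynomial σ ℂ) (t : ℂ) :
    (onCurve w c P).eval t = eval (fun i => t ^ w i * c i) P := by
  induction P using MvPolynomial.induction_on with
  | C a => simp [onCurve]
  | add p q hp hq => simp only [map_add, Polynomial.eval_add] at *; rw [hp, hq]
  | mul_X p i hp =>
    rw [map_mul, map_mul, Polynomial.eval_mul, hp]
    simp [onCurve, mul_comm]

theorem onCurve_monomial (w : σ → ℕ) (c : σ → ℂ) (m : σ →₀ ℕ) (a : ℂ) :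
    onCurve w c (monomial m a) =
      Polynomial.monomial (Finsupp.weight w m) (eval c (monomial m a)) := by
  apply Polynomial.funext
  intro t
  rw [eval_onCurve, eval_monomial, Polynomial.eval_monomial, eval_monomial, Finsupp.weight_apply]
  simp only [Finsupp.prod, Finsupp.sum, mul_pow, Finset.prod_mul_distrib, ← pow_mul,
    Finset.prod_pow_eq_pow_sum, smul_eq_mul]
  simp only [mul_comm (w _)]
  ring

theorem coeff_onCurve (w : σ → ℕ) (c : σ → ℂ) (P : MvPolynomial σ ℂ) (n : ℕ) :
    (onCurve w c P).coeff n = eval c (weightedHomogeneousComponent w n P) := by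
  induction P using MvPolynomial.induction_on' with
  | monomial m a =>
    rw [onCurve_monomial, Polynomial.coeff_monomial,
      weightedHomogeneousComponent_of_mem (isWeightedHomogeneous_monomial w m a rfl)]
    simp only [eq_comm]
    split_ifs <;> simp
  | add p q hp hq => rw [map_add, Polynomial.coeff_add, hp, hq, map_add, map_add]

theorem coeff_onCurve_one (c : σ → ℂ) (P : MvPolynomial σ ℂ) (n : ℕ) :
    (onCurve 1 c P).coeff n = eval c (homogeneousComponent n P) := coeff_onCurve 1 c P n

theorem eval_onCurve_one (c : σ → ℂ) (P : MvPolynomial σ ℂ) (t : ℂ) :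
    (onCurve 1 c P).eval t = eval (fun i => t * c i) P := by
  rw [eval_onCurve]; simp

theorem eval_smul_of_isHomogeneous {P : MvPolynomial σ ℂ} {d : ℕ} (hP : P.IsHomogeneous d)
    (c : σ → ℂ) (t : ℂ) : eval (fun i => t * c i) P = t ^ d * eval c P := by
  have h : onCurve 1 c P = Polynomial.monomial d (eval c P) := by
    ext n
    rw [coeff_onCurve_one, homogeneousComponent_of_mem hP, Polynomial.coeff_monomial]
    simp only [eq_comm]
    split_ifs <;> simp
  rw [← eval_onCurve_one, h, Polynomial.eval_monomial, mul_comm]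

theorem isHomogeneous_of_eval_smul {P : MvPolynomial σ ℂ} {d : ℕ}
    (h : ∀ (c : σ → ℂ) (t : ℂ), eval (fun i => t * c i) P = t ^ d * eval c P) :
    P.IsHomogeneous d := by
  have : P = homogeneousComponent d P := by
    apply MvPolynomial.funext
    intro c
    have h2 : onCurve 1 c P = Polynomial.monomial d (eval c P) := by
      apply Polynomial.funext
      intro t
      rw [eval_onCurve_one, h, Polynomial.eval_monomial, mul_comm]
    rw [← coeff_onCurve_one, h2, Polynomial.coeff_monomial, if_pos rfl]
  rw [this]
  exact homogeneousComponent_isHomogeneous d P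

/-- A set of polynomials is graded if it contains the homogeneous components of its elements. -/
def IsGraded (B : Subalgebra ℂ (MvPolynomial σ ℂ)) : Prop :=
  ∀ x ∈ B, ∀ d, homogeneousComponent d x ∈ B

theorem homogeneousComponent_mul (x y : MvPolynomial σ ℂ) (d : ℕ) :
    homogeneousComponent d (x * y) =
      ∑ i ∈ Finset.range (x.totalDegree + 1), ∑ j ∈ Finset.range (y.totalDegree + 1),
        if d = i + j then homogeneousComponent i x * homogeneousComponent j y else 0 := by
  conv_lhs => rw [← sum_homogeneousComponent x, ← sum_homogeneousComponent y, Finset.sum_mul_sum]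
  simp only [map_sum]
  refine Finset.sum_congr rfl fun i _ => Finset.sum_congr rfl fun j _ => ?_
  exact homogeneousComponent_of_mem
    ((homogeneousComponent_isHomogeneous i x).mul (homogeneousComponent_isHomogeneous j y))

theorem isGraded_adjoin {s : Set (MvPolynomial σ ℂ)} (hs : ∀ x ∈ s, ∃ d, x.IsHomogeneous d) :
    IsGraded (Algebra.adjoin ℂ s) := by
  intro x hx
  induction hx using Algebra.adjoin_induction with
  | mem x hx =>
    intro d
    obtain ⟨e, he⟩ := hs x hx
    rw [homogeneousComponent_of_mem he]
    split_ifs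
    · exact Algebra.subset_adjoin hx
    · exact zero_mem _
  | algebraMap r =>
    intro d
    rw [algebraMap_eq, homogeneousComponent_of_mem (isHomogeneous_C σ r)]
    split_ifs
    · exact Subalgebra.algebraMap_mem _ r
    · exact zero_mem _
  | add x y _ _ hx hy =>
    intro d
    rw [map_add]
    exact add_mem (hx d) (hy d)
  | mul x y _ _ hx hy =>
    intro d
    rw [homogeneousComponent_mul]
    refine sum_mem fun i _ => sum_mem fun j _ => ?_
    split_ifs
    · exact mul_mem (hx i) (hy j)
    · exact zero_mem _

theorem mem_of_homogeneousComponent_mem {B : Subalgebra ℂ (MvPolynomial σ ℂ)}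
    {x : MvPolynomial σ ℂ} (h : ∀ d, homogeneousComponent d x ∈ B) : x ∈ B := by
  rw [← sum_homogeneousComponent x]
  exact sum_mem fun i _ => h i

theorem le_of_forall_exists_add_mul {B R : Subalgebra ℂ (MvPolynomial σ ℂ)} (hB : IsGraded B)
    {F : MvPolynomial σ ℂ} (hFB : F ∈ B) {e : ℕ} (he : 0 < e)
    (hF : F.IsHomogeneous e) (h : ∀ P ∈ R, ∃ y ∈ B, ∃ Q ∈ R, P = y + F * Q) : R ≤ B := by
  have key : ∀ d : ℕ, ∀ P ∈ R, homogeneousComponent d P ∈ B := by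
    intro d
    induction d using Nat.strong_induction_on with
    | _ d ih =>
      intro P hP
      obtain ⟨y, hy, Q, hQ, rfl⟩ := h P hP
      rw [map_add]
      refine add_mem (hB y hy d) ?_
      nth_rw 1 [← sum_homogeneousComponent Q]
      rw [Finset.mul_sum, map_sum]
      refine sum_mem fun i _ => ?_
      rw [homogeneousComponent_of_mem (hF.mul (homogeneousComponent_isHomogeneous i Q))]
      split_ifs with hd
      · exact mul_mem hFB (ih i (by omega) Q hQ)
      · exact zero_mem _
  exact fun P hP => mem_of_homogeneousComponent_mem fun d => key d P hP

/-- Identities of the form `F * f^* Q = F * Q` can be cancelled. -/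
theorem eval_comp_eq_of_mul {F : MvPolynomial σ ℂ} (hF : F ≠ 0) {Q : MvPolynomial σ ℂ}
    (f : σ → MvPolynomial σ ℂ)
    (h : ∀ c, eval c F * eval (fun i => eval c (f i)) Q = eval c F * eval c Q) (c : σ → ℂ) :
    eval (fun i => eval c (f i)) Q = eval c Q := by
  have hb : ∀ c : σ → ℂ, eval c (bind₁ f Q) = eval (fun i => eval c (f i)) Q := by
    intro c
    rw [eval, eval₂Hom_bind₁]
    rfl
  have : F * bind₁ f Q = F * Q := by
    apply MvPolynomial.funext
    intro c
    rw [map_mul, map_mul, hb, h]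
  rw [← hb, mul_left_cancel₀ hF this]

theorem eq_of_eval_eq_of_ne_zero {F P Q : MvPolynomial σ ℂ} (hF : F ≠ 0)
    (h : ∀ c, eval c F ≠ 0 → eval c P = eval c Q) : P = Q := by
  apply mul_left_cancel₀ hF
  apply MvPolynomial.funext
  intro c
  rw [map_mul, map_mul]
  by_cases hc : eval c F = 0
  · rw [hc, zero_mul, zero_mul]
  · rw [h c hc]

theorem sum_filter_eq_of_torus {ι : Type*} (S : Finset ι) (a : ι → ℂ) (p n : ι → ℕ) (A : ℂ)
    (h : ∀ τ : ℂ, τ ≠ 0 → ∑ i ∈ S, a i * (τ ^ p i * τ⁻¹ ^ n i) = A) :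
    ∑ i ∈ S with p i = n i, a i = A := by
  set N := ∑ i ∈ S, n i with hN
  have hle : ∀ i ∈ S, n i ≤ N := fun i hi => Finset.single_le_sum (fun _ _ => Nat.zero_le _) hi
  have hp : ∑ i ∈ S, Polynomial.monomial (p i + (N - n i)) (a i) = Polynomial.monomial N A := by
    refine Polynomial.eq_of_infinite_eval_eq _ _ ((Set.infinite_of_finite_compl
      (s := {(0 : ℂ)}ᶜ) (by simp)).mono ?_)
    intro τ hτ
    have hτ : τ ≠ 0 := hτ
    rw [Set.mem_ofPred_eq, Polynomial.eval_finsetSum, Polynomial.eval_monomial, ← h τ hτ,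
      Finset.sum_mul]
    refine Finset.sum_congr rfl fun i hi => ?_
    rw [Polynomial.eval_monomial]
    have : τ ^ N = τ ^ n i * τ ^ (N - n i) := by rw [← pow_add, Nat.add_sub_cancel' (hle i hi)]
    rw [this, pow_add, inv_pow]
    field_simp
  have := congrArg (fun f => Polynomial.coeff f N) hp
  simp only [Polynomial.finsetSum_coeff, Polynomial.coeff_monomial, if_true] at this
  rw [← this, Finset.sum_filter]
  refine Finset.sum_congr rfl fun i hi => ?_
  have := hle i hi
  simp only [show p i + (N - n i) = N ↔ p i = n i by omega]

end Grading

section Unipotent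

variable {K : Type*} [CommRing K]

/-- First coefficient of the cubic covariant of a binary cubic. -/
def jac₀ (b₀ b₁ b₂ b₃ : K) : K := 3 * b₀ * hes₁ b₀ b₁ b₂ b₃ - 2 * b₁ * hes₀ b₀ b₁ b₂

/-- Discriminant of the Hessian of a binary cubic. -/
def dsc (b₀ b₁ b₂ b₃ : K) : K :=
  hes₁ b₀ b₁ b₂ b₃ ^ 2 - 4 * hes₀ b₀ b₁ b₂ * hes₂ b₁ b₂ b₃

/-- Generators of the invariants of the unipotent group acting on a cubic form and trivially on
two more variables. -/
def semi (c : Fin 6 → K) : Fin 6 → K :=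
  ![c 0, c 1, c 2, hes₀ (c 2) (c 3) (c 4), jac₀ (c 2) (c 3) (c 4) (c 5),
    dsc (c 2) (c 3) (c 4) (c 5)]

theorem map_semi {L : Type*} [CommRing L] (φ : K →+* L) (c : Fin 6 → K) (j : Fin 6) :
    φ (semi c j) = semi (fun i => φ (c i)) j := by
  fin_cases j <;>
  simp only [semi, Fin.reduceFinMk, Fin.zero_eta, Fin.mk_one, Matrix.cons_val, hes₀, jac₀, dsc,
    hes₁, hes₂, map_sub, map_mul, map_pow, map_ofNat]

theorem jac₀_sq (b₀ b₁ b₂ b₃ : K) : jac₀ b₀ b₁ b₂ b₃ ^ 2 =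
    -4 * hes₀ b₀ b₁ b₂ ^ 3 + 9 * b₀ ^ 2 * dsc b₀ b₁ b₂ b₃ := by
  simp only [jac₀, dsc, hes₀, hes₁, hes₂]
  ring

/-- Translation action of the unipotent group. -/
def shift (z : K) (c : Fin 6 → K) : Fin 6 → K :=
  ![c 0, c 1, c 2, c 3 + 3 * z * c 2, c 4 + 2 * z * c 3 + 3 * z ^ 2 * c 2,
    c 5 + z * c 4 + z ^ 2 * c 3 + z ^ 3 * c 2]

/-- The algebra generated by the basic semi-invariants. -/
noncomputable def semiAlg : Subalgebra ℂ (MvPolynomial (Fin 6) ℂ) :=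
  Algebra.adjoin ℂ (Set.range (semi X))

theorem semi_mem (j : Fin 6) : semi X j ∈ semiAlg := Algebra.subset_adjoin ⟨j, rfl⟩

theorem eval_semi (c : Fin 6 → ℂ) (j : Fin 6) : eval c (semi X j) = semi c j := by
  rw [map_semi]
  simp only [eval_X]

theorem exists_pow_mul_eval_eq (p : MvPolynomial (Fin 6) ℂ) :
    ∃ N : ℕ, ∃ y ∈ semiAlg, ∀ c : Fin 6 → ℂ, c 2 ≠ 0 →
      c 2 ^ N * eval ![c 0, c 1, c 2, 0, hes₀ (c 2) (c 3) (c 4) / (3 * c 2),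
        jac₀ (c 2) (c 3) (c 4) (c 5) / (27 * c 2 ^ 2)] p = eval c y := by
  induction p using MvPolynomial.induction_on with
  | C a => exact ⟨0, C a, Subalgebra.algebraMap_mem _ a, fun c _ => by simp⟩
  | add p q hp hq =>
    obtain ⟨N, y, hy, h⟩ := hp
    obtain ⟨N', y', hy', h'⟩ := hq
    refine ⟨N + N', semi X 2 ^ N' * y + semi X 2 ^ N * y', add_mem
      (mul_mem (pow_mem (semi_mem 2) _) hy) (mul_mem (pow_mem (semi_mem 2) _) hy'), fun c hc => ?_⟩
    simp only [map_add, map_mul, map_pow, eval_semi, ← h c hc, ← h' c hc]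
    simp only [semi, Matrix.cons_val]
    ring
  | mul_X p i hp =>
    obtain ⟨N, y, hy, h⟩ := hp
    have key : ∃ M : ℕ, ∃ z ∈ semiAlg, ∀ c : Fin 6 → ℂ, c 2 ≠ 0 →
        c 2 ^ M * (![c 0, c 1, c 2, 0, hes₀ (c 2) (c 3) (c 4) / (3 * c 2),
        jac₀ (c 2) (c 3) (c 4) (c 5) / (27 * c 2 ^ 2)] : Fin 6 → ℂ) i = eval c z := by
      fin_cases i
      · exact ⟨0, semi X 0, semi_mem 0, fun c hc => by rw [eval_semi]; simp [semi]⟩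
      · exact ⟨0, semi X 1, semi_mem 1, fun c hc => by rw [eval_semi]; simp [semi]⟩
      · exact ⟨0, semi X 2, semi_mem 2, fun c hc => by rw [eval_semi]; simp [semi]⟩
      · exact ⟨0, 0, zero_mem _, fun c hc => by simp⟩
      · refine ⟨1, C (1 / 3) * semi X 3, mul_mem (Subalgebra.algebraMap_mem _ _) (semi_mem 3),
          fun c hc => ?_⟩
        rw [map_mul, eval_semi, eval_C]
        simp only [semi, Fin.reduceFinMk, Matrix.cons_val]
        field_simp
      · refine ⟨2, C (1 / 27) * semi X 4, mul_mem (Subalgebra.algebraMap_mem _ _) (semi_mem 4),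
          fun c hc => ?_⟩
        rw [map_mul, eval_semi, eval_C]
        simp only [semi, Fin.reduceFinMk, Matrix.cons_val]
        field_simp
    obtain ⟨M, z, hz, hM⟩ := key
    refine ⟨N + M, y * z, mul_mem hy hz, fun c hc => ?_⟩
    rw [map_mul, map_mul, ← h c hc, ← hM c hc, eval_X]
    ring

theorem exists_normal_form {x : MvPolynomial (Fin 6) ℂ} (hx : x ∈ semiAlg) :
    ∃ x' ∈ semiAlg, ∃ U V : MvPolynomial (Fin 4) ℂ, x = semi X 2 * x' +
      aeval ![semi X 0, semi X 1, semi X 3, semi X 5] U +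
      semi X 4 * aeval ![semi X 0, semi X 1, semi X 3, semi X 5] V := by
  have hmem : ∀ U : MvPolynomial (Fin 4) ℂ,
      aeval ![semi X 0, semi X 1, semi X 3, semi X 5] U ∈ semiAlg := by
    intro U
    induction U using MvPolynomial.induction_on with
    | C a => rw [aeval_C]; exact Subalgebra.algebraMap_mem _ a
    | add p q hp hq => rw [map_add]; exact add_mem hp hq
    | mul_X p i hp =>
      rw [map_mul, aeval_X]
      refine mul_mem hp ?_
      fin_cases i
      exacts [semi_mem 0, semi_mem 1, semi_mem 3, semi_mem 5]
  induction hx using Algebra.adjoin_induction with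
  | mem x hx =>
    obtain ⟨j, rfl⟩ := hx
    fin_cases j
    · exact ⟨0, zero_mem _, X 0, 0, by simp⟩
    · exact ⟨0, zero_mem _, X 1, 0, by simp⟩
    · exact ⟨1, one_mem _, 0, 0, by simp⟩
    · exact ⟨0, zero_mem _, X 2, 0, by simp⟩
    · exact ⟨0, zero_mem _, 0, 1, by simp⟩
    · exact ⟨0, zero_mem _, X 3, 0, by simp⟩
  | algebraMap r => exact ⟨0, zero_mem _, C r, 0, by simp⟩
  | add x y _ _ hx hy =>
    obtain ⟨x', hx', U, V, rfl⟩ := hx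
    obtain ⟨y', hy', U', V', rfl⟩ := hy
    refine ⟨x' + y', add_mem hx' hy', U + U', V + V', ?_⟩
    simp only [map_add]
    ring
  | mul x y hxm hym hx hy =>
    obtain ⟨x', hx', U, V, rfl⟩ := hx
    obtain ⟨y', hy', U', V', rfl⟩ := hy
    have hsq : semi (X : Fin 6 → MvPolynomial (Fin 6) ℂ) 4 ^ 2 =
      -4 * semi X 3 ^ 3 + 9 * semi X 2 ^ 2 * semi X 5 := jac₀_sq _ _ _ _
    refine ⟨x' * (semi X 2 * y' + aeval ![semi X 0, semi X 1, semi X 3, semi X 5] U' +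
      semi X 4 * aeval ![semi X 0, semi X 1, semi X 3, semi X 5] V') +
      y' * (aeval ![semi X 0, semi X 1, semi X 3, semi X 5] U +
      semi X 4 * aeval ![semi X 0, semi X 1, semi X 3, semi X 5] V) +
      9 * semi X 2 * semi X 5 * aeval ![semi X 0, semi X 1, semi X 3, semi X 5] V *
        aeval ![semi X 0, semi X 1, semi X 3, semi X 5] V', ?_,
      U * U' - 4 * X 2 ^ 3 * V * V', U * V' + U' * V, ?_⟩
    · have h9 : (9 : MvPolynomial (Fin 6) ℂ) ∈ semiAlg := ofNat_mem _ 9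
      exact add_mem (add_mem (mul_mem hx' hym) (mul_mem hy' (add_mem (hmem _)
        (mul_mem (semi_mem _) (hmem _))))) (mul_mem (mul_mem (mul_mem (mul_mem h9 (semi_mem _))
        (semi_mem _)) (hmem _)) (hmem _))
    · simp only [map_add, map_mul, map_sub, map_pow, aeval_X, map_ofNat, Matrix.cons_val]
      linear_combination aeval ![semi X 0, semi X 1, semi X 3, semi X 5] V *
        aeval ![semi X 0, semi X 1, semi X 3, semi X 5] V' * hsq

theorem mem_semiAlg_of_mul {p : MvPolynomial (Fin 6) ℂ} (h : X 2 * p ∈ semiAlg) :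
    p ∈ semiAlg := by
  obtain ⟨x', hx', U, V, h⟩ := exists_normal_form h
  have hX : semi (X : Fin 6 → MvPolynomial (Fin 6) ℂ) 2 = X 2 := rfl
  rw [hX] at h
  have he : ∀ (W : MvPolynomial (Fin 4) ℂ) (s t b₁ b₃ : ℂ),
      eval ![s, t, 0, b₁, 0, b₃] (aeval ![semi X 0, semi X 1, semi X 3, semi X 5] W) =
        eval ![s, t, -b₁ ^ 2, 12 * b₁ ^ 3 * b₃] W := by
    intro W s t b₁ b₃
    induction W using MvPolynomial.induction_on with
    | C a => simp
    | add p q hp hq => rw [map_add, map_add, map_add, hp, hq]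
    | mul_X p i hp =>
      rw [map_mul, map_mul, map_mul, hp, aeval_X, eval_X]
      congr 1
      fin_cases i <;> simp [semi, hes₀, dsc, hes₁, hes₂]
      ring
  have h4 : ∀ s t b₁ b₃ : ℂ, eval ![s, t, 0, b₁, 0, b₃] (semi X 4) = 2 * b₁ ^ 3 := by
    intro s t b₁ b₃
    simp [semi, jac₀, hes₁, hes₀]
    ring
  have h1 : ∀ s t b₁ b₃ : ℂ, eval ![s, t, -b₁ ^ 2, 12 * b₁ ^ 3 * b₃] U +
      2 * b₁ ^ 3 * eval ![s, t, -b₁ ^ 2, 12 * b₁ ^ 3 * b₃] V = 0 := by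
    intro s t b₁ b₃
    have := congrArg (eval ![s, t, 0, b₁, 0, b₃]) h
    simp only [map_add, map_mul, he, h4, eval_X, Matrix.cons_val, zero_mul, zero_add] at this
    exact this.symm
  have h2 : ∀ s t b₁ b₃ : ℂ, eval ![s, t, -b₁ ^ 2, 12 * b₁ ^ 3 * b₃] U -
      2 * b₁ ^ 3 * eval ![s, t, -b₁ ^ 2, 12 * b₁ ^ 3 * b₃] V = 0 := by
    intro s t b₁ b₃
    have := h1 s t (-b₁) (-b₃)
    rw [show -(-b₁) ^ 2 = -b₁ ^ 2 by ring, show 12 * (-b₁) ^ 3 * -b₃ = 12 * b₁ ^ 3 * b₃ by ring]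
      at this
    linear_combination this
  have hsurj : ∀ c : Fin 4 → ℂ, c 2 ≠ 0 → ∃ s t b₁ b₃ : ℂ, b₁ ≠ 0 ∧
      c = ![s, t, -b₁ ^ 2, 12 * b₁ ^ 3 * b₃] := by
    intro c hc
    obtain ⟨b, hb⟩ := IsAlgClosed.exists_pow_nat_eq (-c 2) (n := 2) (by norm_num)
    have hb0 : b ≠ 0 := by
      rintro rfl
      apply hc
      linear_combination hb
    refine ⟨c 0, c 1, b, c 3 / (12 * b ^ 3), hb0, ?_⟩
    rw [hb, neg_neg, mul_div_cancel₀ _ (by simp [hb0])]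
    funext i
    fin_cases i <;> rfl
  have hU : U = 0 := by
    refine eq_of_eval_eq_of_ne_zero (X_ne_zero 2) fun c hc => ?_
    rw [eval_X] at hc
    obtain ⟨s, t, b₁, b₃, -, rfl⟩ := hsurj c hc
    rw [map_zero]
    linear_combination (h1 s t b₁ b₃ + h2 s t b₁ b₃) / 2
  have hV : V = 0 := by
    refine eq_of_eval_eq_of_ne_zero (X_ne_zero 2) fun c hc => ?_
    rw [eval_X] at hc
    obtain ⟨s, t, b₁, b₃, hb, rfl⟩ := hsurj c hc
    rw [map_zero]
    have : 4 * b₁ ^ 3 * eval ![s, t, -b₁ ^ 2, 12 * b₁ ^ 3 * b₃] V = 0 := by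
      linear_combination (h1 s t b₁ b₃ - h2 s t b₁ b₃)
    simpa [hb] using this
  rw [hU, hV, map_zero, mul_zero, add_zero, add_zero] at h
  rwa [mul_left_cancel₀ (X_ne_zero 2) h]

theorem mem_semiAlg {p : MvPolynomial (Fin 6) ℂ}
    (h : ∀ z c, eval (shift z c) p = eval c p) : p ∈ semiAlg := by
  obtain ⟨N, y, hy, hN⟩ := exists_pow_mul_eval_eq p
  have key : X 2 ^ N * p = y := by
    refine eq_of_eval_eq_of_ne_zero (X_ne_zero 2) fun c hc => ?_
    rw [eval_X] at hc
    rw [← hN c hc, map_mul, map_pow, eval_X, ← h (-c 3 / (3 * c 2)) c]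
    congr 3
    simp only [shift, hes₀, jac₀, hes₁]
    funext i
    fin_cases i
    · rfl
    · rfl
    · rfl
    · simp only [Fin.reduceFinMk, Matrix.cons_val]
      field_simp
      ring
    · simp only [Fin.reduceFinMk, Matrix.cons_val]
      field_simp
      ring
    · simp only [Fin.reduceFinMk, Matrix.cons_val]
      field_simp
      ring
  have : ∀ n : ℕ, X 2 ^ n * p ∈ semiAlg → p ∈ semiAlg := by
    intro n
    induction n with
    | zero => intro h; simpa using h
    | succ n ih =>
      intro h
      refine ih (mem_semiAlg_of_mul ?_)
      rwa [← mul_assoc, ← pow_succ']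
  exact this N (key ▸ hy)

end Unipotent

section TwoVectors

variable {K : Type*} [CommRing K]

/-- Second coefficient of the cubic covariant of a binary cubic. -/
def jac₁ (b₀ b₁ b₂ b₃ : K) : K :=
  6 * b₀ * hes₂ b₁ b₂ b₃ + b₁ * hes₁ b₀ b₁ b₂ b₃ - 4 * b₂ * hes₀ b₀ b₁ b₂

/-- Third coefficient of the cubic covariant of a binary cubic. -/
def jac₂ (b₀ b₁ b₂ b₃ : K) : K :=
  4 * b₁ * hes₂ b₁ b₂ b₃ - b₂ * hes₁ b₀ b₁ b₂ b₃ - 6 * b₃ * hes₀ b₀ b₁ b₂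

/-- Last coefficient of the cubic covariant of a binary cubic. -/
def jac₃ (b₀ b₁ b₂ b₃ : K) : K :=
  2 * b₂ * hes₂ b₁ b₂ b₃ - 3 * b₃ * hes₁ b₀ b₁ b₂ b₃

/-- Basic invariants of two vectors `v`, `n`, a cubic `b`, its Hessian `h` and its cubic
covariant `t`. -/
def pairOf (v₀ v₁ n₀ n₁ b₀ b₁ b₂ b₃ h₀ h₁ h₂ t₀ t₁ t₂ t₃ : K) : Fin 13 → K :=
  ![v₀ * n₁ - v₁ * n₀,
    ce b₀ b₁ b₂ b₃ v₀ v₁, cp b₀ b₁ b₂ b₃ v₀ v₁ n₀ n₁, cp b₀ b₁ b₂ b₃ n₀ n₁ v₀ v₁,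
    ce b₀ b₁ b₂ b₃ n₀ n₁,
    qe h₀ h₁ h₂ v₀ v₁, qb h₀ h₁ h₂ v₀ v₁ n₀ n₁, qe h₀ h₁ h₂ n₀ n₁,
    ce t₀ t₁ t₂ t₃ v₀ v₁, cp t₀ t₁ t₂ t₃ v₀ v₁ n₀ n₁, cp t₀ t₁ t₂ t₃ n₀ n₁ v₀ v₁,
    ce t₀ t₁ t₂ t₃ n₀ n₁,
    h₁ ^ 2 - 4 * h₀ * h₂]

/-- Basic invariants of two linear forms and a cubic form. -/
def pair (c : Fin 8 → K) : Fin 13 → K :=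
  pairOf (c 1) (-c 0) (c 3) (-c 2) (c 4) (c 5) (c 6) (c 7) (hes₀ (c 4) (c 5) (c 6))
    (hes₁ (c 4) (c 5) (c 6) (c 7)) (hes₂ (c 5) (c 6) (c 7)) (jac₀ (c 4) (c 5) (c 6) (c 7))
    (jac₁ (c 4) (c 5) (c 6) (c 7)) (jac₂ (c 4) (c 5) (c 6) (c 7)) (jac₃ (c 4) (c 5) (c 6) (c 7))

theorem map_pair {L : Type*} [CommRing L] (φ : K →+* L) (c : Fin 8 → K) (j : Fin 13) :
    φ (pair c j) = pair (fun i => φ (c i)) j := by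
  fin_cases j <;>
  simp only [pair, pairOf, Fin.reduceFinMk, Fin.zero_eta, Fin.mk_one, Matrix.cons_val, ce, cp, qe,
    qb, hes₀, hes₁, hes₂, jac₀, jac₁, jac₂, jac₃, map_add, map_sub, map_mul, map_pow, map_neg,
    map_ofNat]

/-- Substitution `x ↦ p x + q y`, `y ↦ r x + s y` on two linear forms and a cubic form. -/
def actPair (p q r s : K) (c : Fin 8 → K) : Fin 8 → K :=
  ![p * c 0 + r * c 1, q * c 0 + s * c 1, p * c 2 + r * c 3, q * c 2 + s * c 3,
    ce (c 4) (c 5) (c 6) (c 7) p r, cp (c 4) (c 5) (c 6) (c 7) p r q s,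
    cp (c 4) (c 5) (c 6) (c 7) q s p r, ce (c 4) (c 5) (c 6) (c 7) q s]

theorem map_actPair {L : Type*} [CommRing L] (φ : K →+* L) (p q r s : K) (c : Fin 8 → K)
    (j : Fin 8) : φ (actPair p q r s c j) =
      actPair (φ p) (φ q) (φ r) (φ s) (fun i => φ (c i)) j := by
  fin_cases j <;>
  simp only [actPair, Fin.reduceFinMk, Fin.zero_eta, Fin.mk_one, Matrix.cons_val, ce, cp,
    map_add, map_mul, map_pow, map_ofNat]

theorem pairOf_act {p q r s : K} (hd : p * s - q * r = 1)
    (v₀ v₁ n₀ n₁ b₀ b₁ b₂ b₃ h₀ h₁ h₂ t₀ t₁ t₂ t₃ : K) :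
    pairOf (s * v₀ - q * v₁) (p * v₁ - r * v₀) (s * n₀ - q * n₁) (p * n₁ - r * n₀)
      (ce b₀ b₁ b₂ b₃ p r) (cp b₀ b₁ b₂ b₃ p r q s) (cp b₀ b₁ b₂ b₃ q s p r)
      (ce b₀ b₁ b₂ b₃ q s) (qe h₀ h₁ h₂ p r) (qb h₀ h₁ h₂ p r q s) (qe h₀ h₁ h₂ q s)
      (ce t₀ t₁ t₂ t₃ p r) (cp t₀ t₁ t₂ t₃ p r q s) (cp t₀ t₁ t₂ t₃ q s p r)
      (ce t₀ t₁ t₂ t₃ q s) =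
    pairOf v₀ v₁ n₀ n₁ b₀ b₁ b₂ b₃ h₀ h₁ h₂ t₀ t₁ t₂ t₃ := by
  have key : ∀ (k : ℕ) {x y : K}, x = (p * s - q * r) ^ k * y → x = y := by
    rintro k x y rfl
    rw [hd, one_pow, one_mul]
  funext j
  fin_cases j <;>
  simp only [pairOf, Fin.reduceFinMk, Fin.zero_eta, Fin.mk_one, Matrix.cons_val]
  · exact key 1 (by ring)
  · exact key 3 (by simp only [ce, cp]; ring)
  · exact key 3 (by simp only [ce, cp]; ring)
  · exact key 3 (by simp only [ce, cp]; ring)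
  · exact key 3 (by simp only [ce, cp]; ring)
  · exact key 2 (by simp only [qe, qb]; ring)
  · exact key 2 (by simp only [qe, qb]; ring)
  · exact key 2 (by simp only [qe, qb]; ring)
  · exact key 3 (by simp only [ce, cp]; ring)
  · exact key 3 (by simp only [ce, cp]; ring)
  · exact key 3 (by simp only [ce, cp]; ring)
  · exact key 3 (by simp only [ce, cp]; ring)
  · exact key 2 (by simp only [qe, qb]; ring)

theorem pair_act {p q r s : K} (hd : p * s - q * r = 1) (c : Fin 8 → K) :
    pair (actPair p q r s c) = pair c := by
  have key : ∀ (k : ℕ) {x y : K}, x = (p * s - q * r) ^ k * y → x = y := by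
    rintro k x y rfl
    rw [hd, one_pow, one_mul]
  refine Eq.trans ?_ (pairOf_act hd _ _ _ _ _ _ _ _ _ _ _ _ _ _ _)
  rw [pair]
  simp only [actPair, Matrix.cons_val]
  congr 1
  · ring
  · ring
  · ring
  · ring
  · exact key 2 (by simp only [qe, ce, cp, hes₀, hes₁, hes₂]; ring)
  · exact key 2 (by simp only [qb, ce, cp, hes₀, hes₁, hes₂]; ring)
  · exact key 2 (by simp only [qe, ce, cp, hes₀, hes₁, hes₂]; ring)
  · exact key 3 (by simp only [ce, cp, hes₀, hes₁, hes₂, jac₀, jac₁, jac₂, jac₃]; ring)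
  · exact key 3 (by simp only [ce, cp, hes₀, hes₁, hes₂, jac₀, jac₁, jac₂, jac₃]; ring)
  · exact key 3 (by simp only [ce, cp, hes₀, hes₁, hes₂, jac₀, jac₁, jac₂, jac₃]; ring)
  · exact key 3 (by simp only [ce, cp, hes₀, hes₁, hes₂, jac₀, jac₁, jac₂, jac₃]; ring)

end TwoVectors

section TwoVectorInvariants

/-- The invariants of two linear forms and a cubic form. -/
def pairInv : Subalgebra ℂ (MvPolynomial (Fin 8) ℂ) where
  carrier := {P | ∀ p q r s : ℂ, p * s - q * r = 1 → ∀ c, eval (actPair p q r s c) P = eval c P}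
  mul_mem' := fun ha hb p q r s hd c => by rw [map_mul, map_mul, ha p q r s hd, hb p q r s hd]
  add_mem' := fun ha hb p q r s hd c => by rw [map_add, map_add, ha p q r s hd, hb p q r s hd]
  algebraMap_mem' := fun a p q r s hd c => by simp

/-- The algebra generated by the basic invariants of two linear forms and a cubic form. -/
noncomputable def pairAlg : Subalgebra ℂ (MvPolynomial (Fin 8) ℂ) :=
  Algebra.adjoin ℂ (Set.range (pair X))

theorem pair_mem (j : Fin 13) : pair X j ∈ pairAlg := Algebra.subset_adjoin ⟨j, rfl⟩

theorem eval_pair (c : Fin 8 → ℂ) (j : Fin 13) : eval c (pair X j) = pair c j := by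
  rw [map_pair]
  simp only [eval_X]

theorem pairAlg_le : pairAlg ≤ pairInv := by
  refine Algebra.adjoin_le ?_
  rintro _ ⟨j, rfl⟩ p q r s hd c
  rw [eval_pair, eval_pair, pair_act hd]

/-- Parametrization of the pairs of multiples of a fixed vector. -/
def parallel {K : Type*} [CommRing K] (c : Fin 6 → K) : Fin 8 → K :=
  ![0, c 0, 0, c 1, c 2, c 3, c 4, c 5]

/-- Restriction to pairs of multiples of a fixed vector. -/
noncomputable def resParallel : MvPolynomial (Fin 8) ℂ →ₐ[ℂ] MvPolynomial (Fin 6) ℂ :=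
  aeval (parallel X)

theorem eval_resParallel (c : Fin 6 → ℂ) (P : MvPolynomial (Fin 8) ℂ) :
    eval c (resParallel P) = eval (parallel c) P := by
  have : (fun i => eval c (parallel X i)) = parallel c := by
    funext i
    fin_cases i <;> simp [parallel]
  rw [resParallel, ← this, aeval_def, eval₂_eq', map_sum]
  rw [eval_eq']
  simp

theorem resParallel_mem_semiAlg {P : MvPolynomial (Fin 8) ℂ} (hP : P ∈ pairInv) :
    resParallel P ∈ semiAlg := by
  apply mem_semiAlg
  intro z c
  rw [eval_resParallel, eval_resParallel, ← hP 1 z 0 1 (by ring) (parallel c)]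
  congr 2
  funext i
  fin_cases i <;> simp [parallel, shift, actPair, ce, cp] <;> ring

theorem pow_mul_pow_mem {A : Type*} [CommRing A] [Algebra ℂ A] {B : Subalgebra ℂ A} {s t x : A}
    {d : ℕ} (h : ∀ i j, i + j = d → s ^ i * t ^ j * x ∈ B) (a : ℕ) :
    ∀ i j, i + j = d * a → s ^ i * t ^ j * x ^ a ∈ B := by
  induction a with
  | zero =>
    intro i j hij
    obtain ⟨rfl, rfl⟩ : i = 0 ∧ j = 0 := by omega
    simp
  | succ a ih =>
    intro i j hij
    rw [mul_add, mul_one] at hij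
    have h1 := h (min i d) (d - min i d) (by omega)
    have h2 := ih (i - min i d) (j - (d - min i d)) (by omega)
    have hi : s ^ i = s ^ min i d * s ^ (i - min i d) := by rw [← pow_add]; congr 1; omega
    have hj : t ^ j = t ^ (d - min i d) * t ^ (j - (d - min i d)) := by
      rw [← pow_add]; congr 1; omega
    have := mul_mem h1 h2
    rw [hi, hj]
    convert this using 1
    ring

theorem pow_mul_pow_mem_mul {A : Type*} [CommRing A] [Algebra ℂ A] {B : Subalgebra ℂ A}
    {s t x y : A} {m n : ℕ} (hx : ∀ i j, i + j = m → s ^ i * t ^ j * x ∈ B)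
    (hy : ∀ i j, i + j = n → s ^ i * t ^ j * y ∈ B) :
    ∀ i j, i + j = m + n → s ^ i * t ^ j * (x * y) ∈ B := by
  intro i j hij
  have h1 := hx (min i m) (m - min i m) (by omega)
  have h2 := hy (i - min i m) (j - (m - min i m)) (by omega)
  have hi : s ^ i = s ^ min i m * s ^ (i - min i m) := by rw [← pow_add]; congr 1; omega
  have hj : t ^ j = t ^ (m - min i m) * t ^ (j - (m - min i m)) := by
    rw [← pow_add]; congr 1; omega
  have := mul_mem h1 h2
  rw [hi, hj]
  convert this using 1
  ring

theorem monomial_mem_map (i j a b e k : ℕ) (h : i + j = 3 * a + 2 * b + 3 * e) :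
    semi X 0 ^ i * semi X 1 ^ j * (semi X 2 ^ a * semi X 3 ^ b * semi X 4 ^ e) * semi X 5 ^ k ∈
      pairAlg.map resParallel := by
  have hm : ∀ (z : ℂ) (j : Fin 13) (x : MvPolynomial (Fin 6) ℂ),
      (∀ c, z * pair (parallel c) j = eval c x) → x ∈ pairAlg.map resParallel := by
    intro z j x hx
    refine ⟨C z * pair X j, mul_mem (Subalgebra.algebraMap_mem _ z) (pair_mem j), ?_⟩
    apply MvPolynomial.funext
    intro c
    refine (eval_resParallel c _).trans ?_
    rw [← hx, map_mul, eval_pair, eval_C]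
  have h2 : ∀ i j, i + j = 3 → semi X 0 ^ i * semi X 1 ^ j * semi X 2 ∈
      pairAlg.map resParallel := by
    intro i j hij
    obtain ⟨rfl, rfl⟩ | ⟨rfl, rfl⟩ | ⟨rfl, rfl⟩ | ⟨rfl, rfl⟩ : (i = 3 ∧ j = 0) ∨ (i = 2 ∧ j = 1) ∨
      (i = 1 ∧ j = 2) ∨ (i = 0 ∧ j = 3) := by omega
    · refine hm 1 1 _ fun c => ?_
      simp only [map_mul, map_pow, eval_semi]
      simp [semi, pair, pairOf, parallel, ce]
      ring
    · refine hm (1 / 3) 2 _ fun c => ?_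
      simp only [map_mul, map_pow, eval_semi]
      simp [semi, pair, pairOf, parallel, cp]
      ring
    · refine hm (1 / 3) 3 _ fun c => ?_
      simp only [map_mul, map_pow, eval_semi]
      simp [semi, pair, pairOf, parallel, cp]
      ring
    · refine hm 1 4 _ fun c => ?_
      simp only [map_mul, map_pow, eval_semi]
      simp [semi, pair, pairOf, parallel, ce]
      ring
  have h3 : ∀ i j, i + j = 2 → semi X 0 ^ i * semi X 1 ^ j * semi X 3 ∈
      pairAlg.map resParallel := by
    intro i j hij
    obtain ⟨rfl, rfl⟩ | ⟨rfl, rfl⟩ | ⟨rfl, rfl⟩ : (i = 2 ∧ j = 0) ∨ (i = 1 ∧ j = 1) ∨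
      (i = 0 ∧ j = 2) := by omega
    · refine hm 1 5 _ fun c => ?_
      simp only [map_mul, map_pow, eval_semi]
      simp [semi, pair, pairOf, parallel, qe]
      ring
    · refine hm (1 / 2) 6 _ fun c => ?_
      simp only [map_mul, map_pow, eval_semi]
      simp [semi, pair, pairOf, parallel, qb]
      ring
    · refine hm 1 7 _ fun c => ?_
      simp only [map_mul, map_pow, eval_semi]
      simp [semi, pair, pairOf, parallel, qe]
      ring
  have h4 : ∀ i j, i + j = 3 → semi X 0 ^ i * semi X 1 ^ j * semi X 4 ∈
      pairAlg.map resParallel := by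
    intro i j hij
    obtain ⟨rfl, rfl⟩ | ⟨rfl, rfl⟩ | ⟨rfl, rfl⟩ | ⟨rfl, rfl⟩ : (i = 3 ∧ j = 0) ∨ (i = 2 ∧ j = 1) ∨
      (i = 1 ∧ j = 2) ∨ (i = 0 ∧ j = 3) := by omega
    · refine hm 1 8 _ fun c => ?_
      simp only [map_mul, map_pow, eval_semi]
      simp [semi, pair, pairOf, parallel, ce]
      ring
    · refine hm (1 / 3) 9 _ fun c => ?_
      simp only [map_mul, map_pow, eval_semi]
      simp [semi, pair, pairOf, parallel, cp]
      ring
    · refine hm (1 / 3) 10 _ fun c => ?_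
      simp only [map_mul, map_pow, eval_semi]
      simp [semi, pair, pairOf, parallel, cp]
      ring
    · refine hm 1 11 _ fun c => ?_
      simp only [map_mul, map_pow, eval_semi]
      simp [semi, pair, pairOf, parallel, ce]
      ring
  have h5 : semi X 5 ∈ pairAlg.map resParallel := by
    refine hm 1 12 _ fun c => ?_
    rw [eval_semi]
    simp [semi, pair, pairOf, parallel, dsc]
  exact mul_mem (pow_mul_pow_mem_mul (pow_mul_pow_mem_mul (pow_mul_pow_mem h2 a)
    (pow_mul_pow_mem h3 b)) (pow_mul_pow_mem h4 e) i j h) (pow_mem h5 k)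

theorem resParallel_mem_map {P : MvPolynomial (Fin 8) ℂ} (hP : P ∈ pairInv) :
    resParallel P ∈ pairAlg.map resParallel := by
  have h := resParallel_mem_semiAlg hP
  rw [semiAlg, Algebra.adjoin_range_eq_range_aeval] at h
  obtain ⟨F, hF⟩ := h
  have hF : aeval (semi X) F = resParallel P := hF
  have hev : ∀ c, eval c (aeval (semi X) F) = eval (semi c) F := by
    intro c
    rw [aeval_def, eval₂_eq', map_sum, eval_eq']
    simp [eval_semi]
  have key : resParallel P = ∑ m ∈ F.support with m 0 + m 1 = 3 * m 2 + 2 * m 3 + 3 * m 4,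
      C (F.coeff m) * (semi X 0 ^ m 0 * semi X 1 ^ m 1 *
        (semi X 2 ^ m 2 * semi X 3 ^ m 3 * semi X 4 ^ m 4) * semi X 5 ^ m 5) := by
    apply MvPolynomial.funext
    intro c
    rw [map_sum]
    simp only [map_mul, eval_C, map_pow, eval_semi]
    symm
    apply sum_filter_eq_of_torus
    intro τ hτ
    rw [eval_resParallel, ← hP τ⁻¹ 0 0 τ (by field_simp; simp) (parallel c)]
    have hc : actPair τ⁻¹ 0 0 τ (parallel c) = parallel ![τ * c 0, τ * c 1, τ⁻¹ ^ 3 * c 2,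
        τ⁻¹ * c 3, τ * c 4, τ ^ 3 * c 5] := by
      funext i
      fin_cases i <;> simp [parallel, actPair, ce, cp] <;> field_simp
    rw [hc, ← eval_resParallel, ← hF, hev, eval_eq']
    refine Finset.sum_congr rfl fun m _ => ?_
    rw [Fin.prod_univ_six]
    have h0 : semi ![τ * c 0, τ * c 1, τ⁻¹ ^ 3 * c 2, τ⁻¹ * c 3, τ * c 4, τ ^ 3 * c 5] =
        ![τ * semi c 0, τ * semi c 1, τ⁻¹ ^ 3 * semi c 2, τ⁻¹ ^ 2 * semi c 3,
          τ⁻¹ ^ 3 * semi c 4, semi c 5] := by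
      funext i
      fin_cases i <;> simp [semi, hes₀, jac₀, dsc, hes₁, hes₂] <;> field_simp
    rw [h0]
    simp only [Matrix.cons_val]
    ring
  rw [key]
  refine sum_mem fun m hm => mul_mem (Subalgebra.algebraMap_mem _ _)
    (monomial_mem_map _ _ _ _ _ _ (Finset.mem_filter.mp hm).2)

end TwoVectorInvariants

section TwoVectorTheorem

theorem exists_pow_mul_eq_add (P : MvPolynomial (Fin 8) ℂ) :
    ∃ (N : ℕ) (Q R : MvPolynomial (Fin 8) ℂ), X 3 ^ N * P = pair X 0 * Q + R ∧
      ∀ (c : Fin 8 → ℂ) (z : ℂ), eval (Function.update c 0 z) R = eval c R := by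
  induction P using MvPolynomial.induction_on with
  | C a => exact ⟨0, 0, C a, by simp, fun c z => by simp⟩
  | add P P' h h' =>
    obtain ⟨N, Q, R, hP, hR⟩ := h
    obtain ⟨N', Q', R', hP', hR'⟩ := h'
    refine ⟨N + N', X 3 ^ N' * Q + X 3 ^ N * Q', X 3 ^ N' * R + X 3 ^ N * R', ?_, fun c z => ?_⟩
    · linear_combination X 3 ^ N' * hP + X 3 ^ N * hP'
    · simp [hR, hR']
  | mul_X P i h =>
    obtain ⟨N, Q, R, hP, hR⟩ := h
    by_cases hi : i = 0
    · subst hi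
      refine ⟨N + 1, X 3 * X 0 * Q + R, X 1 * X 2 * R, ?_, fun c z => ?_⟩
      · have hw : pair (X : Fin 8 → MvPolynomial (Fin 8) ℂ) 0 = X 0 * X 3 - X 1 * X 2 := by
          simp [pair, pairOf]
          ring
        linear_combination X 3 * X 0 * hP - R * hw
      · simp [hR]
    · refine ⟨N, Q * X i, R * X i, ?_, fun c z => ?_⟩
      · linear_combination X i * hP
      · simp [hR, hi]

theorem pair_zero_ne_zero : pair (X : Fin 8 → MvPolynomial (Fin 8) ℂ) 0 ≠ 0 := by
  intro h
  have := congrArg (eval ![1, 0, 0, 1, 0, 0, 0, 0]) h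
  rw [eval_pair] at this
  simp [pair, pairOf] at this

theorem not_X_dvd_pair_zero : ¬ X 3 ∣ pair (X : Fin 8 → MvPolynomial (Fin 8) ℂ) 0 := by
  rintro ⟨Q, h⟩
  have := congrArg (eval ![0, 1, 1, 0, 0, 0, 0, 0]) h
  rw [eval_pair] at this
  simp [pair, pairOf] at this

theorem pair_zero_dvd {P : MvPolynomial (Fin 8) ℂ}
    (h : ∀ c : Fin 8 → ℂ, pair c 0 = 0 → c 3 ≠ 0 → eval c P = 0) : pair X 0 ∣ P := by
  obtain ⟨N, Q, R, hP, hR⟩ := exists_pow_mul_eq_add P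
  have hR0 : R = 0 := by
    refine eq_of_eval_eq_of_ne_zero (X_ne_zero 3) fun c hc => ?_
    rw [eval_X] at hc
    have h3 : Function.update c 0 (c 1 * c 2 / c 3) 3 = c 3 := by simp
    have hw : pair (Function.update c 0 (c 1 * c 2 / c 3)) 0 = 0 := by
      simp [pair, pairOf]
      field_simp
      ring
    have := congrArg (eval (Function.update c 0 (c 1 * c 2 / c 3))) hP
    rw [map_mul, map_add, map_mul, eval_pair, hw, hR, h _ hw (by rwa [h3])] at this
    rw [map_zero]
    linear_combination -this
  rw [hR0, add_zero] at hP
  obtain ⟨Q', rfl⟩ := X_prime.pow_dvd_of_dvd_mul_left N not_X_dvd_pair_zero ⟨P, hP.symm⟩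
  refine ⟨Q', mul_left_cancel₀ (pow_ne_zero N (X_ne_zero 3)) ?_⟩
  rw [hP]
  ring

theorem pairInv_le : pairInv ≤ pairAlg := by
  have hg : ∀ j, ∃ d, (pair X j : MvPolynomial (Fin 8) ℂ).IsHomogeneous d := by
    intro j
    refine ⟨(![2, 4, 4, 4, 4, 4, 4, 4, 6, 6, 6, 6, 4] : Fin 13 → ℕ) j,
      isHomogeneous_of_eval_smul fun c t => ?_⟩
    rw [eval_pair, eval_pair]
    fin_cases j <;>
    simp only [pair, pairOf, Fin.reduceFinMk, Fin.zero_eta, Fin.mk_one, Matrix.cons_val, ce, cp, qe,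
      qb, hes₀, hes₁, hes₂, jac₀, jac₁, jac₂, jac₃] <;> ring
  refine le_of_forall_exists_add_mul (F := pair X 0) (e := 2) (isGraded_adjoin ?_)
    (pair_mem 0) (by norm_num) (isHomogeneous_of_eval_smul fun c t => ?_) fun P hP => ?_
  · rintro _ ⟨j, rfl⟩
    exact hg j
  · rw [eval_pair, eval_pair]
    simp [pair, pairOf]
    ring
  obtain ⟨y, hy, hyP⟩ := resParallel_mem_map hP
  have hyP : resParallel y = resParallel P := hyP
  have hz : P - y ∈ pairInv := sub_mem hP (pairAlg_le hy)
  obtain ⟨Q, hQ⟩ : pair X 0 ∣ P - y := by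
    refine pair_zero_dvd fun c hw hc => ?_
    rw [← hz 1 0 (-c 2 / c 3) 1 (by ring) c]
    set c' := actPair 1 0 (-c 2 / c 3) 1 c with hc'
    have : c' = parallel ![c' 1, c' 3, c' 4, c' 5, c' 6, c' 7] := by
      funext i
      fin_cases i
      · simp [pair, pairOf] at hw
        simp [c', parallel, actPair]
        field_simp
        linear_combination hw
      · rfl
      · simp [c', parallel, actPair]
        field_simp
        ring
      all_goals rfl
    rw [this, ← eval_resParallel, map_sub, hyP, sub_self, map_zero]
  refine ⟨y, hy, Q, ?_, by rw [← hQ]; ring⟩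
  intro p q r s hd c
  have hact : ∀ c, actPair p q r s c = fun i => eval c (actPair (C p) (C q) (C r) (C s) X i) := by
    intro c
    funext i
    rw [map_actPair]
    simp only [eval_C, eval_X]
  rw [hact]
  refine eval_comp_eq_of_mul pair_zero_ne_zero _ (fun c => ?_) c
  have := hz p q r s hd c
  rw [hQ, map_mul, map_mul, eval_pair, eval_pair, pair_act hd, hact] at this
  rw [eval_pair]
  exact this

end TwoVectorTheorem

section Squares

variable {K : Type*} [CommRing K]

/-- The triple of forms `(l, m², b)` attached to two linear forms `l`, `m` and a cubic `b`. -/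
def sq (c : Fin 8 → K) : Idx ![1, 2, 3] → K :=
  tup (c 0) (c 1) (c 2 ^ 2) (2 * c 2 * c 3) (c 3 ^ 2) (c 4) (c 5) (c 6) (c 7)

theorem map_sq {L : Type*} [CommRing L] (φ : K →+* L) (c : Fin 8 → K) :
    (fun i => φ (sq c i)) = sq (fun i => φ (c i)) := by
  rw [sq, comp_tup φ]
  simp only [sq, map_mul, map_pow, map_ofNat]

theorem act_sq (p q r s : K) (c : Fin 8 → K) :
    act p q r s (sq c) = sq (actPair p q r s c) := by
  rw [funext_iff, forall_idx]
  refine ⟨rfl, rfl, ?_, ?_, ?_, rfl, rfl, rfl, rfl⟩ <;>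
  simp only [act, sq, tup, Matrix.cons_val, qe, qb, actPair] <;> ring

/-- Change of sign of the second linear form. -/
def flip (c : Fin 8 → K) : Fin 8 → K := ![c 0, c 1, -c 2, -c 3, c 4, c 5, c 6, c 7]

theorem sq_flip (c : Fin 8 → K) : sq (flip c) = sq c := by
  simp [sq, flip]

/-- Indices of the basic pair invariants which are odd in the second linear form. -/
def oddIdx : Fin 6 → Fin 13 := ![0, 2, 4, 6, 9, 11]

theorem pair_flip_odd (c : Fin 8 → K) (i : Fin 6) :
    pair (flip c) (oddIdx i) = -pair c (oddIdx i) := by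
  fin_cases i <;>
  simp only [oddIdx, pair, pairOf, flip, Fin.reduceFinMk, Fin.zero_eta, Fin.mk_one,
    Matrix.cons_val, ce, cp, qe, qb] <;> ring

theorem genFam_sq (c : Fin 8 → K) (j : Fin 15) :
    3 * genFam (sq c) j = (![0, 3 * pair c 0 ^ 2, 3 * pair c 3, 6 * pair c 7, 3 * pair c 1,
      3 * pair c 5, 18 * pair c 0 * pair c 4, 3 * pair c 12, 6 * pair c 0 * pair c 2,
      6 * pair c 0 * pair c 6, -pair c 10, 27 * pair c 4 ^ 2, 3 * pair c 8,
      -6 * pair c 0 * pair c 11, -18 * pair c 4 * pair c 11] : Fin 15 → K) j := by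
  fin_cases j <;>
  simp only [sq, genFam_tup, gens, gensOf, pair, pairOf, Fin.reduceFinMk, Fin.zero_eta, Fin.mk_one,
    Matrix.cons_val, ce, cp, qe, qb, hes₀, hes₁, hes₂, jac₀, jac₁, jac₂, jac₃, lin₀, lin₁] <;> ring

/-- Restriction to triples `(l, m², b)`. -/
noncomputable def resSq : Pol →ₐ[ℂ] MvPolynomial (Fin 8) ℂ := aeval (sq X)

theorem eval_resSq (c : Fin 8 → ℂ) (P : Pol) : eval c (resSq P) = eval (sq c) P := by
  have : (fun i => eval c (sq X i)) = sq c := by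
    rw [map_sq (eval c)]
    simp only [eval_X]
  rw [resSq, ← this, aeval_def, eval₂_eq', map_sum]
  rw [eval_eq']
  simp

/-- The image of the algebra generated by the fifteen basic invariants under `resSq`. -/
noncomputable def sqAlg : Subalgebra ℂ (MvPolynomial (Fin 8) ℂ) := genAlg.map resSq

theorem mem_of_mul_mem {A : Type*} [CommRing A] [Algebra ℂ A] {B : Subalgebra ℂ A}
    (n : ℕ) [NeZero n] {x : A} (h : n * x ∈ B) : x ∈ B := by
  have hn : (n : ℂ) ≠ 0 := by exact_mod_cast NeZero.ne n
  have := B.smul_mem h ((n : ℂ)⁻¹)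
  rwa [← nsmul_eq_mul, ← Nat.cast_smul_eq_nsmul ℂ, smul_smul, inv_mul_cancel₀ hn, one_smul] at this

theorem genFam_sq_mem (j : Fin 15) : 3 * genFam (sq X) j ∈ sqAlg :=
  mul_mem (ofNat_mem sqAlg 3) ⟨G j, G_mem_genAlg j, aeval_G _ j⟩

end Squares

section EvenPart

theorem sqAlg_gens :
    (pair X 0 ^ 2 ∈ sqAlg ∧ pair X 3 ∈ sqAlg ∧ pair X 7 ∈ sqAlg ∧ pair X 1 ∈ sqAlg ∧
    pair X 5 ∈ sqAlg) ∧ (pair X 0 * pair X 4 ∈ sqAlg ∧ pair X 12 ∈ sqAlg ∧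
    pair X 0 * pair X 2 ∈ sqAlg ∧ pair X 0 * pair X 6 ∈ sqAlg ∧ pair X 10 ∈ sqAlg) ∧
    (pair X 4 ^ 2 ∈ sqAlg ∧ pair X 8 ∈ sqAlg ∧ pair X 0 * pair X 11 ∈ sqAlg ∧
    pair X 4 * pair X 11 ∈ sqAlg) := by
  have key : ∀ (n : ℕ) [NeZero n] (j : Fin 15) {x : MvPolynomial (Fin 8) ℂ},
      3 * genFam (sq X) j = (n : MvPolynomial (Fin 8) ℂ) * x ∨
        3 * genFam (sq X) j = -((n : MvPolynomial (Fin 8) ℂ) * x) → x ∈ sqAlg := by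
    rintro n _ j x (h | h)
    · exact mem_of_mul_mem n (h ▸ genFam_sq_mem j)
    · exact mem_of_mul_mem n (neg_mem_iff.1 (h ▸ genFam_sq_mem j))
  refine ⟨⟨key 3 1 (.inl ?_), key 3 2 (.inl ?_), key 6 3 (.inl ?_), key 3 4 (.inl ?_),
    key 3 5 (.inl ?_)⟩, ⟨key 18 6 (.inl ?_), key 3 7 (.inl ?_), key 6 8 (.inl ?_),
    key 6 9 (.inl ?_), key 1 10 (.inr ?_)⟩, ⟨key 27 11 (.inl ?_), key 3 12 (.inl ?_),
    key 6 13 (.inr ?_), key 18 14 (.inr ?_)⟩⟩ <;>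
  rw [genFam_sq] <;> simp only [Matrix.cons_val] <;> push_cast <;> ring

theorem pair_rel {K : Type*} [CommRing K] (c : Fin 8 → K) :
    (pair c 0 * pair c 9 = -(3 * pair c 3 * pair c 5) + 9 * pair c 1 * pair c 7 ∧
    pair c 2 ^ 2 = 3 * pair c 1 * pair c 3 - pair c 0 ^ 2 * pair c 5 ∧
    3 * (pair c 2 * pair c 4) = pair c 3 ^ 2 + pair c 0 ^ 2 * pair c 7 ∧
    pair c 2 * pair c 6 = pair c 3 * pair c 5 + 3 * pair c 1 * pair c 7) ∧
    (pair c 2 * pair c 9 = -(3 * pair c 5 * (pair c 0 * pair c 6)) + 3 * pair c 3 * pair c 8 ∧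
    3 * (pair c 2 * pair c 11) =
      -(3 * pair c 7 * (pair c 0 * pair c 6)) + pair c 3 * pair c 10 ∧
    3 * (pair c 4 * pair c 6) = -(pair c 0 * pair c 11) + 2 * pair c 3 * pair c 7 ∧
    3 * (pair c 4 * pair c 9) = 3 * pair c 7 * (pair c 0 * pair c 6) + pair c 3 * pair c 10) ∧
    (pair c 6 ^ 2 = 4 * pair c 5 * pair c 7 + pair c 0 ^ 2 * pair c 12 ∧
    pair c 6 * pair c 9 = -(3 * pair c 12 * (pair c 0 * pair c 2)) + 6 * pair c 7 * pair c 8 ∧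
    3 * (pair c 6 * pair c 11) =
      -(9 * pair c 12 * (pair c 0 * pair c 4)) + 2 * pair c 7 * pair c 10 ∧
    2 * pair c 9 ^ 2 = 3 * pair c 8 * pair c 10 - 36 * pair c 5 ^ 2 * pair c 7 +
      27 * pair c 1 * pair c 3 * pair c 12) ∧
    3 * (pair c 9 * pair c 11) = pair c 10 ^ 2 - 9 * pair c 0 ^ 2 * pair c 7 * pair c 12 ∧
    pair c 11 ^ 2 = 9 * pair c 12 * pair c 4 ^ 2 - 4 * pair c 7 ^ 3 := by
  refine ⟨⟨?_, ?_, ?_, ?_⟩, ⟨?_, ?_, ?_, ?_⟩, ⟨?_, ?_, ?_, ?_⟩, ?_, ?_⟩ <;>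
  simp only [pair, pairOf, Matrix.cons_val, ce, cp, qe, qb, hes₀, hes₁, hes₂, jac₀, jac₁, jac₂,
    jac₃] <;> ring

theorem odd_mul_mem (i j : Fin 6) : pair X (oddIdx i) * pair X (oddIdx j) ∈ sqAlg := by
  obtain ⟨⟨h1, h2, h3, h4, h5⟩, ⟨h6, h7, h8, h9, h10⟩, h11, h12, h13, h14⟩ := sqAlg_gens
  obtain ⟨⟨r1, r2, r3, r4⟩, ⟨r5, r6, r7, r8⟩, ⟨r9, r10, r11, r12⟩, r13, r14⟩ :=
    pair_rel (X : Fin 8 → MvPolynomial (Fin 8) ℂ)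
  have m2 : (2 : MvPolynomial (Fin 8) ℂ) ∈ sqAlg := ofNat_mem _ 2
  have m3 : (3 : MvPolynomial (Fin 8) ℂ) ∈ sqAlg := ofNat_mem _ 3
  have m4 : (4 : MvPolynomial (Fin 8) ℂ) ∈ sqAlg := ofNat_mem _ 4
  have m6 : (6 : MvPolynomial (Fin 8) ℂ) ∈ sqAlg := ofNat_mem _ 6
  have m9 : (9 : MvPolynomial (Fin 8) ℂ) ∈ sqAlg := ofNat_mem _ 9
  have m27 : (27 : MvPolynomial (Fin 8) ℂ) ∈ sqAlg := ofNat_mem _ 27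
  have m36 : (36 : MvPolynomial (Fin 8) ℂ) ∈ sqAlg := ofNat_mem _ 36
  generalize (pair X : Fin 13 → MvPolynomial (Fin 8) ℂ) = P at *
  have k : (P 0 * P 9 ∈ sqAlg ∧ P 2 ^ 2 ∈ sqAlg ∧ 3 * (P 2 * P 4) ∈ sqAlg ∧ P 2 * P 6 ∈ sqAlg) ∧
      (P 2 * P 9 ∈ sqAlg ∧ 3 * (P 2 * P 11) ∈ sqAlg ∧ 3 * (P 4 * P 6) ∈ sqAlg ∧
      3 * (P 4 * P 9) ∈ sqAlg) ∧ (P 6 ^ 2 ∈ sqAlg ∧ P 6 * P 9 ∈ sqAlg ∧ 3 * (P 6 * P 11) ∈ sqAlg ∧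
      2 * P 9 ^ 2 ∈ sqAlg) ∧ 3 * (P 9 * P 11) ∈ sqAlg ∧ P 11 ^ 2 ∈ sqAlg := by
    rw [r1, r2, r3, r4, r5, r6, r7, r8, r9, r10, r11, r12, r13, r14]
    refine ⟨⟨?_, ?_, ?_, ?_⟩, ⟨?_, ?_, ?_, ?_⟩, ⟨?_, ?_, ?_, ?_⟩, ?_, ?_⟩
    all_goals with_reducible
      repeat' first
        | assumption
        | refine add_mem ?_ ?_
        | refine sub_mem ?_ ?_
        | refine neg_mem ?_
        | refine mul_mem ?_ ?_
        | refine pow_mem ?_ _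
  obtain ⟨⟨k1, k2, k3, k4⟩, ⟨k5, k6, k7, k8⟩, ⟨k9, k10, k11, k12⟩, k13, k14⟩ := k
  have key : ∀ i j : Fin 6, i ≤ j → P (oddIdx i) * P (oddIdx j) ∈ sqAlg := by
    have d3 {x : MvPolynomial (Fin 8) ℂ} (h : 3 * x ∈ sqAlg) : x ∈ sqAlg :=
      mem_of_mul_mem 3 (by exact_mod_cast h)
    have d2 {x : MvPolynomial (Fin 8) ℂ} (h : 2 * x ∈ sqAlg) : x ∈ sqAlg :=
      mem_of_mul_mem 2 (by exact_mod_cast h)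
    rw [pow_two] at h1 k2 h11 k9 k12 k14
    intro i j hij
    fin_cases i <;> fin_cases j <;>
    simp only [oddIdx, Fin.reduceFinMk, Fin.zero_eta, Fin.mk_one, Matrix.cons_val] <;>
    (try exact absurd hij (by decide)) <;>
    with_reducible
    first
      | assumption
      | exact d3 (by assumption)
      | exact d2 (by assumption)
  rcases le_total i j with h | h
  · exact key i j h
  · rw [mul_comm]
    exact key j i h

end EvenPart

section Generation

theorem exists_even_add_odd {x : MvPolynomial (Fin 8) ℂ} (hx : x ∈ pairAlg) :
    ∃ e ∈ sqAlg, ∃ f : Fin 6 → MvPolynomial (Fin 8) ℂ, (∀ i, f i ∈ sqAlg) ∧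
      x = e + ∑ i, f i * pair X (oddIdx i) := by
  induction hx using Algebra.adjoin_induction with
  | mem x h =>
    obtain ⟨j, rfl⟩ := h
    obtain ⟨⟨h1, h2, h3, h4, h5⟩, ⟨h6, h7, h8, h9, h10⟩, h11, h12, h13, h14⟩ := sqAlg_gens
    have even {y : MvPolynomial (Fin 8) ℂ} (hy : y ∈ sqAlg) :
        ∃ e ∈ sqAlg, ∃ f : Fin 6 → MvPolynomial (Fin 8) ℂ, (∀ i, f i ∈ sqAlg) ∧
        y = e + ∑ i, f i * pair X (oddIdx i) :=
      ⟨y, hy, 0, fun _ => zero_mem _, by simp⟩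
    have odd (i : Fin 6) : ∃ e ∈ sqAlg, ∃ f : Fin 6 → MvPolynomial (Fin 8) ℂ,
        (∀ i, f i ∈ sqAlg) ∧ pair X (oddIdx i) = e + ∑ i, f i * pair X (oddIdx i) := by
      refine ⟨0, zero_mem _, Pi.single i 1, fun k => ?_, ?_⟩
      · by_cases h : k = i
        · subst h
          rw [Pi.single_eq_same]
          exact one_mem _
        · rw [Pi.single_eq_of_ne h]
          exact zero_mem _
      · simp [Pi.single_apply]
    fin_cases j
    exacts [odd 0, even h4, odd 1, even h2, odd 2, even h5, odd 3, even h3, even h12, odd 4,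
      even h10, odd 5, even h7]
  | algebraMap r => exact ⟨_, algebraMap_mem _ r, 0, fun _ => zero_mem _, by simp⟩
  | add x y _ _ hx hy =>
    obtain ⟨e, he, f, hf, rfl⟩ := hx
    obtain ⟨e', he', f', hf', rfl⟩ := hy
    refine ⟨e + e', add_mem he he', f + f', fun i => add_mem (hf i) (hf' i), ?_⟩
    simp only [Pi.add_apply, add_mul, Finset.sum_add_distrib]
    ring
  | mul x y _ _ hx hy =>
    obtain ⟨e, he, f, hf, rfl⟩ := hx
    obtain ⟨e', he', f', hf', rfl⟩ := hy
    refine ⟨e * e' + ∑ i, ∑ j, f i * f' j * (pair X (oddIdx i) * pair X (oddIdx j)),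
      add_mem (mul_mem he he') (sum_mem fun i _ => sum_mem fun j _ =>
        mul_mem (mul_mem (hf i) (hf' j)) (odd_mul_mem i j)),
      fun i => e * f' i + e' * f i,
      fun i => add_mem (mul_mem he (hf' i)) (mul_mem he' (hf i)), ?_⟩
    have h : ∑ i, ∑ j, f i * f' j * (pair X (oddIdx i) * pair X (oddIdx j)) =
        (∑ i, f i * pair X (oddIdx i)) * ∑ j, f' j * pair X (oddIdx j) := by
      rw [Finset.sum_mul_sum]
      exact Finset.sum_congr rfl fun i _ => Finset.sum_congr rfl fun j _ => by ring
    rw [h]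
    simp only [add_mul, Finset.sum_add_distrib, mul_assoc, ← Finset.mul_sum]
    ring

theorem eval_flip_of_mem_sqAlg {x : MvPolynomial (Fin 8) ℂ} (hx : x ∈ sqAlg) (c : Fin 8 → ℂ) :
    eval (flip c) x = eval c x := by
  obtain ⟨y, -, rfl⟩ := hx
  change eval _ (resSq y) = eval _ (resSq y)
  rw [eval_resSq, eval_resSq, sq_flip]

theorem resSq_mem {P : Pol} (hP : P ∈ invariantRing ![1, 2, 3]) : resSq P ∈ sqAlg := by
  have hp : resSq P ∈ pairInv := by
    intro p q r s hd c
    rw [eval_resSq, eval_resSq, ← act_sq, eval_act hP hd]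
  obtain ⟨e, he, f, hf, h⟩ := exists_even_add_odd (pairInv_le hp)
  have h0 : ∑ i, f i * pair X (oddIdx i) = 0 := by
    refine MvPolynomial.funext fun c => ?_
    have h1 := congrArg (eval c) h
    have h2 := congrArg (eval (flip c)) h
    rw [eval_resSq, map_add] at h1 h2
    rw [sq_flip, h1, eval_flip_of_mem_sqAlg he] at h2
    have h3 : eval (flip c) (∑ i, f i * pair X (oddIdx i)) =
        -eval c (∑ i, f i * pair X (oddIdx i)) := by
      simp only [map_sum, map_mul, eval_pair, pair_flip_odd, mul_neg, Finset.sum_neg_distrib,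
        eval_flip_of_mem_sqAlg (hf _)]
    rw [h3] at h2
    rw [map_zero]
    linear_combination h2 / 2
  rw [h, h0, add_zero]
  exact he

theorem G_zero : G 0 = X ⟨1, (1 : Fin 3)⟩ ^ 2 - 4 * X ⟨1, (0 : Fin 3)⟩ * X ⟨1, (2 : Fin 3)⟩ := rfl

theorem exists_eq_G_zero_mul_add (P : Pol) :
    ∃ Q r r' : Pol, P = G 0 * Q + r + X ⟨1, (1 : Fin 3)⟩ * r' ∧
      ∀ l₀ l₁ a₀ a₁ a₂ b₀ b₁ b₂ b₃ z : ℂ,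
        eval (tup l₀ l₁ a₀ z a₂ b₀ b₁ b₂ b₃) r = eval (tup l₀ l₁ a₀ a₁ a₂ b₀ b₁ b₂ b₃) r ∧
        eval (tup l₀ l₁ a₀ z a₂ b₀ b₁ b₂ b₃) r' = eval (tup l₀ l₁ a₀ a₁ a₂ b₀ b₁ b₂ b₃) r' := by
  induction P using MvPolynomial.induction_on with
  | C a => exact ⟨0, C a, 0, by simp, by simp⟩
  | add P P' h h' =>
    obtain ⟨Q, r, s, hP, hr⟩ := h
    obtain ⟨Q', r', s', hP', hr'⟩ := h'
    refine ⟨Q + Q', r + r', s + s', ?_, fun l₀ l₁ a₀ a₁ a₂ b₀ b₁ b₂ b₃ z => ?_⟩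
    · rw [hP, hP']
      ring
    · simp only [map_add, (hr l₀ l₁ a₀ a₁ a₂ b₀ b₁ b₂ b₃ z).1,
        (hr l₀ l₁ a₀ a₁ a₂ b₀ b₁ b₂ b₃ z).2, (hr' l₀ l₁ a₀ a₁ a₂ b₀ b₁ b₂ b₃ z).1,
        (hr' l₀ l₁ a₀ a₁ a₂ b₀ b₁ b₂ b₃ z).2, and_self]
  | mul_X P i h =>
    obtain ⟨Q, r, s, hP, hr⟩ := h
    by_cases hi : ∀ l₀ l₁ a₀ a₁ a₂ b₀ b₁ b₂ b₃ z : ℂ,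
        tup l₀ l₁ a₀ z a₂ b₀ b₁ b₂ b₃ i = tup l₀ l₁ a₀ a₁ a₂ b₀ b₁ b₂ b₃ i
    · refine ⟨Q * X i, r * X i, s * X i, ?_, fun l₀ l₁ a₀ a₁ a₂ b₀ b₁ b₂ b₃ z => ?_⟩
      · rw [hP]
        ring
      · simp only [map_mul, (hr l₀ l₁ a₀ a₁ a₂ b₀ b₁ b₂ b₃ z).1,
          (hr l₀ l₁ a₀ a₁ a₂ b₀ b₁ b₂ b₃ z).2, eval_X, hi l₀ l₁ a₀ a₁ a₂ b₀ b₁ b₂ b₃ z, and_self]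
    · obtain rfl : i = ⟨1, (1 : Fin 3)⟩ := by
        revert hi
        revert i
        rw [forall_idx]
        refine ⟨?_, ?_, ?_, fun _ => rfl, ?_, ?_, ?_, ?_, ?_⟩ <;>
        exact fun h => absurd (fun _ _ _ _ _ _ _ _ _ _ => rfl) h
      refine ⟨Q * X ⟨1, (1 : Fin 3)⟩ + s, 4 * X ⟨1, (0 : Fin 3)⟩ * X ⟨1, (2 : Fin 3)⟩ * s, r, ?_,
        fun l₀ l₁ a₀ a₁ a₂ b₀ b₁ b₂ b₃ z => ⟨?_, (hr l₀ l₁ a₀ a₁ a₂ b₀ b₁ b₂ b₃ z).1⟩⟩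
      · rw [hP, G_zero]
        ring
      · simp only [map_mul, (hr l₀ l₁ a₀ a₁ a₂ b₀ b₁ b₂ b₃ z).2, eval_X, map_ofNat]
        rfl

theorem G_zero_dvd {P : Pol} (h : ∀ c : Fin 8 → ℂ, eval (sq c) P = 0) : G 0 ∣ P := by
  obtain ⟨Q, r, s, hP, hr⟩ := exists_eq_G_zero_mul_add P
  have key : ∀ l₀ l₁ m₀ m₁ b₀ b₁ b₂ b₃ a₁ : ℂ,
      eval (tup l₀ l₁ (m₀ ^ 2) a₁ (m₁ ^ 2) b₀ b₁ b₂ b₃) r +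
      2 * m₀ * m₁ * eval (tup l₀ l₁ (m₀ ^ 2) a₁ (m₁ ^ 2) b₀ b₁ b₂ b₃) s = 0 := by
    intro l₀ l₁ m₀ m₁ b₀ b₁ b₂ b₃ a₁
    have h1 := h ![l₀, l₁, m₀, m₁, b₀, b₁, b₂, b₃]
    have h2 : sq ![l₀, l₁, m₀, m₁, b₀, b₁, b₂, b₃] =
      tup l₀ l₁ (m₀ ^ 2) (2 * m₀ * m₁) (m₁ ^ 2) b₀ b₁ b₂ b₃ := rfl
    have h3 := hr l₀ l₁ (m₀ ^ 2) a₁ (m₁ ^ 2) b₀ b₁ b₂ b₃ (2 * m₀ * m₁)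
    have h4 : genFam (tup l₀ l₁ (m₀ ^ 2) (2 * m₀ * m₁) (m₁ ^ 2) b₀ b₁ b₂ b₃) 0 = 0 := by
      change (2 * m₀ * m₁) ^ 2 - 4 * m₀ ^ 2 * m₁ ^ 2 = 0
      ring
    rw [h2, hP, map_add, map_add, map_mul, map_mul, eval_G, h4, h3.1, h3.2, eval_X] at h1
    rw [← h1, zero_mul, zero_add]
    rfl
  have key' : ∀ c : Idx ![1, 2, 3] → ℂ, eval c r = 0 ∧
      c ⟨1, (0 : Fin 3)⟩ * c ⟨1, (2 : Fin 3)⟩ * eval c s = 0 := by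
    intro c
    obtain ⟨l₀, l₁, a₀, a₁, a₂, b₀, b₁, b₂, b₃, rfl⟩ := exists_eq_tup c
    obtain ⟨m₀, rfl⟩ := IsAlgClosed.exists_pow_nat_eq a₀ (n := 2) (by norm_num)
    obtain ⟨m₁, rfl⟩ := IsAlgClosed.exists_pow_nat_eq a₂ (n := 2) (by norm_num)
    have h1 := key l₀ l₁ m₀ m₁ b₀ b₁ b₂ b₃ a₁
    have h2 := key l₀ l₁ (-m₀) m₁ b₀ b₁ b₂ b₃ a₁
    rw [neg_sq] at h2
    constructor
    · linear_combination h1 / 2 + h2 / 2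
    · change m₀ ^ 2 * m₁ ^ 2 * _ = 0
      linear_combination m₀ * m₁ * (h1 / 4 - h2 / 4)
  have hr0 : r = 0 := MvPolynomial.funext fun c => by rw [(key' c).1, map_zero]
  have hs0 : s = 0 := by
    refine eq_of_eval_eq_of_ne_zero (F := X ⟨1, (0 : Fin 3)⟩ * X ⟨1, (2 : Fin 3)⟩)
      (mul_ne_zero (X_ne_zero _) (X_ne_zero _)) fun c hc => ?_
    rw [map_mul, eval_X, eval_X] at hc
    rw [map_zero]
    exact (mul_eq_zero.1 (key' c).2).resolve_left hc
  exact ⟨Q, by rw [hP, hr0, hs0]; ring⟩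

/-- The degree of the basic invariants in the linear form. -/
def degL : Fin 15 → ℕ := ![0, 2, 1, 0, 3, 2, 1, 0, 3, 2, 1, 0, 3, 1, 0]
/-- The degree of the basic invariants in the quadratic form. -/
def degA : Fin 15 → ℕ := ![2, 1, 1, 1, 0, 0, 2, 0, 1, 1, 1, 3, 0, 2, 3]
/-- The degree of the basic invariants in the cubic form. -/
def degB : Fin 15 → ℕ := ![0, 0, 1, 2, 1, 2, 1, 4, 1, 2, 3, 2, 3, 3, 4]

theorem gens_scale {K : Type*} [CommRing K] (u v w l₀ l₁ a₀ a₁ a₂ b₀ b₁ b₂ b₃ : K) (j : Fin 15) :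
    gens (u * l₀) (u * l₁) (v * a₀) (v * a₁) (v * a₂) (w * b₀) (w * b₁) (w * b₂) (w * b₃) j =
      u ^ degL j * v ^ degA j * w ^ degB j * gens l₀ l₁ a₀ a₁ a₂ b₀ b₁ b₂ b₃ j := by
  fin_cases j <;>
  simp only [gens, gensOf, degL, degA, degB, Fin.reduceFinMk, Fin.zero_eta, Fin.mk_one,
    Matrix.cons_val, ce, cp, qe, qb, hes₀, hes₁, hes₂, lin₀, lin₁] <;> ring

theorem genFam_smul (t : ℂ) (c : Idx ![1, 2, 3] → ℂ) (j : Fin 15) :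
    genFam (fun i => t * c i) j = t ^ gdeg j * genFam c j := by
  refine (gens_scale t t t _ _ _ _ _ _ _ _ _ j).trans ?_
  rw [← pow_add, ← pow_add]
  congr 2
  fin_cases j <;> rfl

theorem G_isHomogeneous (j : Fin 15) : (G j).IsHomogeneous (gdeg j) :=
  isHomogeneous_of_eval_smul fun c t => by rw [eval_G, eval_G, genFam_smul]

theorem G_zero_ne_zero : G 0 ≠ 0 := by
  intro h
  have := congrArg (eval (tup 0 0 0 1 0 0 0 0 0)) h
  rw [eval_G] at this
  change (1 : ℂ) ^ 2 - 4 * 0 * 0 = _ at this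
  norm_num at this

theorem invariantRing_eq : invariantRing ![1, 2, 3] = genAlg := by
  refine le_antisymm (le_of_forall_exists_add_mul (F := G 0) (e := 2)
    (isGraded_adjoin ?_) (G_mem_genAlg 0) (by norm_num) (G_isHomogeneous 0) fun P hP => ?_) genAlg_le
  · rintro _ ⟨j, rfl⟩
    exact ⟨_, G_isHomogeneous j⟩
  obtain ⟨y, hy, hyP⟩ := resSq_mem hP
  have hyP : resSq y = resSq P := hyP
  have hz : P - y ∈ invariantRing ![1, 2, 3] := sub_mem hP (genAlg_le hy)
  obtain ⟨Q, hQ⟩ : G 0 ∣ P - y := by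
    refine G_zero_dvd fun c => ?_
    rw [← eval_resSq, map_sub, hyP, sub_self, map_zero]
  refine ⟨y, hy, Q, ?_, by rw [← hQ]; ring⟩
  intro g c
  have hd : (g⁻¹).1 0 0 * (g⁻¹).1 1 1 - (g⁻¹).1 0 1 * (g⁻¹).1 1 0 = 1 := by
    have := (g⁻¹).2
    rwa [Matrix.det_fin_two] at this
  rw [actPt_eq]
  generalize (g⁻¹).1 0 0 = p, (g⁻¹).1 0 1 = q, (g⁻¹).1 1 0 = r, (g⁻¹).1 1 1 = s at hd
  have hact : ∀ c, act p q r s c = fun i => eval c (act (C p) (C q) (C r) (C s) X i) := by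
    intro c
    rw [act, act, comp_tup (eval c)]
    simp [qe, qb, ce, cp]
  rw [hact]
  refine eval_comp_eq_of_mul G_zero_ne_zero _ (fun c => ?_) c
  have := eval_act hz hd c
  rw [hQ, map_mul, map_mul, eval_G, eval_G, genFam_act hd, hact] at this
  rw [eval_G]
  exact this

end Generation

section Minimality

/-- The algebra homomorphism sending the `j`-th variable to the monomial whose exponents are the
multidegree of the `j`-th basic invariant, with coefficient `a j`. -/
noncomputable def toMulti (a : Fin 15 → ℂ) : MvPolynomial (Fin 15) ℂ →ₐ[ℂ] MvPolynomial (Fin 3) ℂ :=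
  aeval fun j => C (a j) * (X 0 ^ degL j * X 1 ^ degA j * X 2 ^ degB j)

theorem toMulti_eq_zero {F : MvPolynomial (Fin 15) ℂ} (hF : aeval G F = 0)
    (c : Idx ![1, 2, 3] → ℂ) : toMulti (genFam c) F = 0 := by
  refine MvPolynomial.funext fun t => ?_
  obtain ⟨l₀, l₁, a₀, a₁, a₂, b₀, b₁, b₂, b₃, rfl⟩ := exists_eq_tup c
  set c' := tup (t 0 * l₀) (t 0 * l₁) (t 1 * a₀) (t 1 * a₁) (t 1 * a₂) (t 2 * b₀) (t 2 * b₁)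
    (t 2 * b₂) (t 2 * b₃)
  have h1 : ∀ φ : MvPolynomial (Fin 15) ℂ →ₐ[ℂ] ℂ, φ F = aeval (fun j => φ (X j)) F := by
    intro φ
    rw [← comp_aeval_apply, aeval_X_left_apply]
  have h2 : (aeval t).comp (toMulti (genFam (tup l₀ l₁ a₀ a₁ a₂ b₀ b₁ b₂ b₃))) F =
      (aeval c').comp (aeval G) F := by
    rw [h1, h1 ((aeval c').comp (aeval G))]
    congr 2
    funext j
    simp only [AlgHom.comp_apply, toMulti, aeval_X, map_mul, aeval_C, map_pow, Algebra.algebraMap_self,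
      RingHom.id_apply]
    rw [aeval_G]
    refine (mul_comm _ _).trans (gens_scale (t 0) (t 1) (t 2) l₀ l₁ a₀ a₁ a₂ b₀ b₁ b₂ b₃ j).symm
  rw [AlgHom.comp_apply, AlgHom.comp_apply, hF, map_zero] at h2
  rw [map_zero]
  exact h2

theorem coeff_toMulti (a : Fin 15 → ℂ) (F : MvPolynomial (Fin 15) ℂ) (m : Fin 3 →₀ ℕ) :
    coeff m (toMulti a F) = ∑ s ∈ F.support,
      if ∑ j, s j * degL j = m 0 ∧ ∑ j, s j * degA j = m 1 ∧ ∑ j, s j * degB j = m 2 then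
        coeff s F * ∏ j, a j ^ s j else 0 := by
  rw [toMulti, aeval_def, eval₂_eq', coeff_sum]
  refine Finset.sum_congr rfl fun s _ => ?_
  have : ∏ i, (C (a i) * (X 0 ^ degL i * X 1 ^ degA i * X 2 ^ degB i)) ^ s i =
      C (∏ j, a j ^ s j) * monomial (Finsupp.equivFunOnFinite.symm
        ![∑ j, s j * degL j, ∑ j, s j * degA j, ∑ j, s j * degB j]) 1 := by
    rw [monomial_eq, Finsupp.prod_fintype _ _ (by simp), Fin.prod_univ_three]
    simp only [mul_pow, Finset.prod_mul_distrib, ← pow_mul, Finset.prod_pow_eq_pow_sum, map_prod,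
      map_pow, map_one, one_mul, mul_comm (degL _), mul_comm (degA _), mul_comm (degB _)]
    rfl
  rw [this, ← mul_assoc, algebraMap_eq, ← C_mul, C_mul_monomial, coeff_monomial, mul_one]
  congr 1
  rw [Finsupp.ext_iff, Fin.forall_fin_succ, Fin.forall_fin_succ, Fin.forall_fin_succ]
  simp

/-- For each basic invariant, a triple of forms with few nonvanishing basic invariants. -/
def testPoint : Fin 15 → Idx ![1, 2, 3] → ℤ :=
    ![tup 0 1 0 1 0 0 0 0 0, tup 0 1 1 0 0 0 0 0 0, tup 0 1 0 0 1 1 0 0 0,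
      tup 0 0 0 0 1 0 1 0 0, tup 0 1 0 0 0 1 0 0 0, tup 0 1 0 0 0 0 1 0 0,
      tup 0 1 1 0 0 0 0 0 1, tup 0 0 0 0 0 0 1 0 1, tup 0 1 0 1 0 1 0 0 0,
      tup 0 1 0 1 0 0 1 0 0, tup 0 1 0 0 1 0 1 0 0, tup 0 0 0 0 1 1 0 0 0,
      tup 0 1 0 0 0 0 1 0 0, tup 0 1 0 1 0 1 0 1 0, tup 0 0 (-1) 1 2 0 0 1 0]

theorem genFam_testPoint (j : Fin 15) : genFam (testPoint j) j ≠ 0 := by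
  revert j
  decide

theorem eq_single_of_multidegree {j : Fin 15} {s : Fin 15 →₀ ℕ}
    (h : ∀ i, genFam (testPoint j) i = 0 → s i = 0)
    (hL : ∑ i, s i * degL i = degL j) (hA : ∑ i, s i * degA i = degA j)
    (hB : ∑ i, s i * degB i = degB j) : s = Finsupp.single j 1 := by
  have he : ∀ p : Fin 15 → Prop, (p 0 ∧ p 1 ∧ p 2 ∧ p 3 ∧ p 4) ∧ (p 5 ∧ p 6 ∧ p 7 ∧ p 8 ∧ p 9) ∧
      (p 10 ∧ p 11 ∧ p 12 ∧ p 13 ∧ p 14) ↔ ∀ j, p j := by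
    intro p
    constructor
    · rintro ⟨⟨h0, h1, h2, h3, h4⟩, ⟨h5, h6, h7, h8, h9⟩, h10, h11, h12, h13, h14⟩ j
      fin_cases j <;> assumption
    · intro h
      exact ⟨⟨h _, h _, h _, h _, h _⟩, ⟨h _, h _, h _, h _, h _⟩, h _, h _, h _, h _, h _⟩
  simp only [Fin.sum_univ_succ, Finset.univ_eq_empty, Finset.sum_empty] at hL hA hB
  rw [Finsupp.ext_iff, ← he]
  rw [← he] at h
  obtain ⟨⟨h0, h1, h2, h3, h4⟩, ⟨h5, h6, h7, h8, h9⟩, h10, h11, h12, h13, h14⟩ := h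
  fin_cases j
  all_goals
    first | replace h0 := h0 (by decide) | clear h0
    first | replace h1 := h1 (by decide) | clear h1
    first | replace h2 := h2 (by decide) | clear h2
    first | replace h3 := h3 (by decide) | clear h3
    first | replace h4 := h4 (by decide) | clear h4
    first | replace h5 := h5 (by decide) | clear h5
    first | replace h6 := h6 (by decide) | clear h6
    first | replace h7 := h7 (by decide) | clear h7
    first | replace h8 := h8 (by decide) | clear h8
    first | replace h9 := h9 (by decide) | clear h9
    first | replace h10 := h10 (by decide) | clear h10
    first | replace h11 := h11 (by decide) | clear h11
    first | replace h12 := h12 (by decide) | clear h12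
    first | replace h13 := h13 (by decide) | clear h13
    first | replace h14 := h14 (by decide) | clear h14
    simp [degL, degA, degB, *] at hL hA hB ⊢
    first
      | omega
      | (have : s 12 = 0 := by omega
         omega)

theorem coeff_eq_zero_of_aeval_G_eq_zero {F : MvPolynomial (Fin 15) ℂ} (hF : aeval G F = 0)
    (j : Fin 15) : coeff (Finsupp.single j 1) F = 0 := by
  set c : Idx ![1, 2, 3] → ℂ := fun i => (testPoint j i : ℂ)
  have hc : ∀ i, genFam c i = ((genFam (testPoint j) i : ℤ) : ℂ) := fun i =>
    (map_genFam (Int.castRingHom ℂ) (testPoint j) i).symm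
  have h := congrArg (coeff (Finsupp.equivFunOnFinite.symm ![degL j, degA j, degB j]))
    (toMulti_eq_zero hF c)
  rw [coeff_toMulti, coeff_zero, Finset.sum_eq_single (Finsupp.single j 1)] at h
  · simpa [hc, genFam_testPoint, Finsupp.single_apply, Finset.prod_ite_eq, pow_ite] using h
  · intro s _ hs
    rw [ite_eq_right_iff]
    rintro ⟨hL, hA, hB⟩
    by_contra h0
    refine hs (eq_single_of_multidegree (fun i hi => ?_) hL hA hB)
    by_contra hsi
    refine h0 (mul_eq_zero_of_right _ (Finset.prod_eq_zero (Finset.mem_univ i) ?_))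
    rw [hc, hi, Int.cast_zero, zero_pow hsi]
  · intro hs
    rw [notMem_support_iff.1 hs, zero_mul, ite_self]

theorem aeval_G_range : (aeval G : MvPolynomial (Fin 15) ℂ →ₐ[ℂ] Pol).range = genAlg :=
  (Algebra.adjoin_range_eq_range_aeval ℂ G).symm

/-- The vector of linear coefficients of a polynomial in fifteen variables. -/
noncomputable def linPart : MvPolynomial (Fin 15) ℂ →ₗ[ℂ] Fin 15 → ℂ :=
  LinearMap.pi fun j => MvPolynomial.lcoeff ℂ (Finsupp.single j 1)

theorem linPart_mul (F H : MvPolynomial (Fin 15) ℂ) :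
    linPart (F * H) = constantCoeff H • linPart F + constantCoeff F • linPart H := by
  funext j
  have h : ∀ F : MvPolynomial (Fin 15) ℂ, linPart F j = constantCoeff (pderiv j F) := by
    intro F
    rw [constantCoeff_eq, coeff_pderiv]
    simp [linPart]
  rw [h, Derivation.leibniz, Pi.add_apply, Pi.smul_apply, Pi.smul_apply, h, h]
  simp
  ring

theorem le_card_of_adjoin_eq {S : Finset Pol}
    (hS : Algebra.adjoin ℂ (S : Set Pol) = genAlg) : 15 ≤ S.card := by
  classical
  have h1 : ∀ x : S, ∃ F : MvPolynomial (Fin 15) ℂ, aeval G F = x.1 := by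
    intro x
    have : x.1 ∈ genAlg := hS ▸ Algebra.subset_adjoin x.2
    rwa [← aeval_G_range] at this
  choose F hF using h1
  set A := Algebra.adjoin ℂ (Set.range F)
  have h2 : A.map (aeval G) = genAlg := by
    rw [AlgHom.map_adjoin, ← hS, ← Set.range_comp]
    congr 1
    ext x
    constructor
    · rintro ⟨y, rfl⟩
      rw [Function.comp_apply, hF]
      exact y.2
    · intro hx
      exact ⟨⟨x, hx⟩, hF _⟩
  have h3 : ∀ H ∈ A, linPart H ∈ Submodule.span ℂ (Set.range (linPart ∘ F)) := by
    intro H hH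
    induction hH using Algebra.adjoin_induction with
    | mem x hx =>
      obtain ⟨y, rfl⟩ := hx
      exact Submodule.subset_span ⟨y, rfl⟩
    | algebraMap r =>
      have : linPart (algebraMap ℂ (MvPolynomial (Fin 15) ℂ) r) = 0 := by
        funext j
        have h0 : (0 : Fin 15 →₀ ℕ) ≠ Finsupp.single j 1 := (Finsupp.single_ne_zero.2 one_ne_zero).symm
        simp [linPart, algebraMap_eq, coeff_C, h0]
      rw [this]
      exact zero_mem _
    | add x y _ _ hx hy =>
      rw [map_add]
      exact add_mem hx hy
    | mul x y _ _ hx hy =>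
      rw [linPart_mul]
      exact add_mem (Submodule.smul_mem _ _ hx) (Submodule.smul_mem _ _ hy)
  have h4 : Submodule.span ℂ (Set.range (linPart ∘ F)) = ⊤ := by
    rw [eq_top_iff, ← (Pi.basisFun ℂ (Fin 15)).span_eq, Submodule.span_le]
    rintro _ ⟨j, rfl⟩
    obtain ⟨H, hH, hHj⟩ : G j ∈ A.map (aeval G) := h2 ▸ G_mem_genAlg j
    have hHj : aeval G H = G j := hHj
    have h5 : linPart (H - X j) = 0 := by
      funext k
      exact coeff_eq_zero_of_aeval_G_eq_zero (F := H - X j)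
        (by rw [map_sub, hHj, aeval_X, sub_self]) k
    have h6 : linPart (X j) = Pi.basisFun ℂ (Fin 15) j := by
      funext k
      simp [linPart, coeff_X, Pi.single_apply, Finsupp.single_left_inj, eq_comm]
    rw [map_sub, sub_eq_zero] at h5
    rw [SetLike.mem_coe, ← h6, ← h5]
    exact h3 H hH
  have h7 := finrank_range_le_card (R := ℂ) (linPart ∘ F)
  rw [Set.finrank, h4, finrank_top, Module.finrank_fin_fun, Fintype.card_coe] at h7
  exact h7

theorem G_injective : Function.Injective G := by
  intro i j hij
  by_contra hne
  have := coeff_eq_zero_of_aeval_G_eq_zero (F := X i - X j) (by simp [hij]) i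
  simp [coeff_X, Finsupp.single_left_inj, Ne.symm hne] at this

theorem hasMinimalGens :
    HasMinimalGens ![1, 2, 3] ![2, 3, 3, 3, 4, 4, 4, 4, 5, 5, 5, 5, 6, 6, 7] := by
  classical
  refine ⟨⟨⟨Finset.univ.image G, ?_, ?_⟩, ?_⟩, G, G_injective, G_isHomogeneous,
    invariantRing_eq.symm⟩
  · rw [Finset.card_image_of_injective _ G_injective, Finset.card_univ, Fintype.card_fin]
  · rw [Finset.coe_image, Finset.coe_univ, Set.image_univ, invariantRing_eq]
    rfl
  · rintro k ⟨S, rfl, hS⟩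
    exact le_card_of_adjoin_eq (hS.trans invariantRing_eq)

end Minimality

section Syzygies

variable {K : Type*} [CommRing K]

/-- Nine syzygies between the basic invariants. -/
structure Syzygies (g : Fin 15 → K) : Prop where
  sq_twelve : g 12 ^ 2 = 9 * g 4 ^ 2 * g 7 - 4 * g 5 ^ 3
  mul_twelve : g 0 * g 12 = 2 * g 5 * g 6 + g 3 * g 8 - 2 * g 2 * g 9
  sq_nine : g 9 ^ 2 = 4 * g 1 ^ 2 * g 7 + 4 * g 0 * g 5 ^ 2 + 8 * g 1 * g 3 * g 5
  sq_six : g 6 ^ 2 = 4 * g 1 * g 11 + g 0 * g 2 ^ 2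
  sq_eight : g 8 ^ 2 = -4 * g 1 ^ 2 * g 5 + 12 * g 1 * g 2 * g 4 + 9 * g 0 * g 4 ^ 2
  pow_two : 8 * g 2 ^ 4 = -2 * g 5 * g 6 ^ 2 - 3 * g 2 * g 6 * g 9 + 24 * g 2 * g 4 * g 11 +
    8 * g 1 * g 5 * g 11 + 2 * g 1 * g 2 * g 13
  sq_ten : g 10 ^ 2 = g 0 * g 5 * g 7 - g 3 ^ 2 * g 5 + g 2 ^ 2 * g 7
  sq_thirteen : g 13 ^ 2 = g 0 ^ 2 * g 5 * g 7 + 2 * g 0 * g 1 * g 3 * g 7 +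
    4 * g 7 * g 1 * g 11 - g 0 * g 3 ^ 2 * g 5 + g 0 * g 2 ^ 2 * g 7 - 2 * g 1 * g 3 ^ 3
  sq_fourteen : 4 * g 14 ^ 2 = g 0 ^ 3 * g 7 ^ 2 - 2 * g 0 ^ 2 * g 3 ^ 2 * g 7 +
    8 * g 0 * g 3 * g 7 * g 11 + 16 * g 7 * g 11 ^ 2 + g 0 * g 3 ^ 4 - 8 * g 3 ^ 3 * g 11

set_option maxHeartbeats 4000000 in
theorem syzygies_gens (l₀ l₁ a₀ a₁ a₂ b₀ b₁ b₂ b₃ : K) :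
    Syzygies (gens l₀ l₁ a₀ a₁ a₂ b₀ b₁ b₂ b₃) := by
  constructor <;>
  · simp only [gens, gensOf, Matrix.cons_val, qe, qb, ce, cp, hes₀, hes₁, hes₂, lin₀, lin₁]
    ring

theorem Syzygies.map {L : Type*} [CommRing L] {g : Fin 15 → K} (h : Syzygies g) (φ : K →+* L) :
    Syzygies fun j => φ (g j) := by
  obtain ⟨h1, h2, h3, h4, h5, h6, h7, h8, h9⟩ := h
  constructor
  · simpa [map_ofNat] using congrArg φ h1
  · simpa [map_ofNat] using congrArg φ h2
  · simpa [map_ofNat] using congrArg φ h3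
  · simpa [map_ofNat] using congrArg φ h4
  · simpa [map_ofNat] using congrArg φ h5
  · simpa [map_ofNat] using congrArg φ h6
  · simpa [map_ofNat] using congrArg φ h7
  · simpa [map_ofNat] using congrArg φ h8
  · simpa [map_ofNat] using congrArg φ h9

/-- In characteristic zero, the syzygies force all basic invariants to vanish once the six
parameters do. -/
theorem Syzygies.eq_zero [IsDomain K] [CharZero K] {g : Fin 15 → K} (h : Syzygies g)
    (h1 : g 1 = 0) (h3 : g 3 = 0) (h4 : g 4 + g 0 ^ 2 = 0) (h5 : g 5 = 0)
    (h7 : g 7 + g 0 ^ 2 = 0) (h11 : g 11 = 0) : ∀ j, g j = 0 := by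
  have h9 : g 9 = 0 := by
    have := h.sq_nine
    simp [h1, h5] at this
    exact this
  have h012 : g 0 * g 12 = 0 := by
    rw [h.mul_twelve, h3, h5, h9]
    ring
  have h0 : g 0 = 0 := by
    rcases mul_eq_zero.1 h012 with h0 | h12
    · exact h0
    · have := h.sq_twelve
      rw [h12, h5, eq_neg_of_add_eq_zero_left h4, eq_neg_of_add_eq_zero_left h7] at this
      have h9 : (9 : K) * g 0 ^ 6 = 0 := by linear_combination this
      simpa using h9
  have h4 : g 4 = 0 := by simpa [h0] using h4
  have h7 : g 7 = 0 := by simpa [h0] using h7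
  have h12 : g 12 = 0 := by simpa [h4, h5] using h.sq_twelve
  have h6 : g 6 = 0 := by simpa [h0, h1] using h.sq_six
  have h8 : g 8 = 0 := by simpa [h0, h1] using h.sq_eight
  have h2 : g 2 = 0 := by simpa [h1, h4, h5, h6] using h.pow_two
  have h10 : g 10 = 0 := by simpa [h5, h7] using h.sq_ten
  have h13 : g 13 = 0 := by simpa [h0, h1, h7] using h.sq_thirteen
  have h14 : g 14 = 0 := by simpa [h0, h3, h7] using h.sq_fourteen
  intro j
  fin_cases j <;> assumption

end Syzygies

section Integrality

variable {σ ι κ : Type*} [Fintype ι] [Fintype κ]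

theorem homogeneousComponent_mem_span {g : ι → MvPolynomial σ ℂ} {e : ι → ℕ}
    (hg : ∀ i, (g i).IsHomogeneous (e i)) {x : MvPolynomial σ ℂ}
    (hx : x ∈ Algebra.adjoin ℂ (Set.range g)) (n : ℕ) :
    homogeneousComponent n x ∈ Submodule.span ℂ
      {y | ∃ s : ι → ℕ, ∑ i, e i * s i = n ∧ y = ∏ i, g i ^ s i} := by
  rw [Algebra.adjoin_range_eq_range_aeval] at hx
  obtain ⟨F, rfl⟩ := hx
  change homogeneousComponent n (aeval g F) ∈ _
  rw [aeval_def, eval₂_eq', map_sum]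
  refine sum_mem fun s _ => ?_
  rw [algebraMap_eq, homogeneousComponent_C_mul]
  rw [← smul_eq_C_mul]
  refine Submodule.smul_mem _ _ ?_
  have h : (∏ i, g i ^ s i).IsHomogeneous (∑ i, e i * s i) :=
    IsHomogeneous.prod _ _ _ fun i _ => (hg i).pow _
  by_cases hn : ∑ i, e i * s i = n
  · rw [homogeneousComponent_of_mem h, if_pos hn.symm]
    exact Submodule.subset_span ⟨s, hn, rfl⟩
  · rw [homogeneousComponent_of_mem h, if_neg (Ne.symm hn)]
    exact zero_mem _

theorem homogeneousComponent_mul_of_isHomogeneous {p x : MvPolynomial σ ℂ} {d : ℕ}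
    (hp : p.IsHomogeneous d) (n : ℕ) :
    homogeneousComponent n (p * x) =
      if d ≤ n then p * homogeneousComponent (n - d) x else 0 := by
  classical
  have h : ∀ i, homogeneousComponent n (p * homogeneousComponent i x) =
      if n = d + i then p * homogeneousComponent i x else 0 := fun i =>
    homogeneousComponent_of_mem (hp.mul (homogeneousComponent_isHomogeneous i x))
  conv_lhs => rw [← sum_homogeneousComponent x, Finset.mul_sum, map_sum]
  rw [Finset.sum_congr rfl fun i _ => h i]
  split_ifs with hd
  · rw [Finset.sum_eq_single (n - d)]
    · rw [if_pos (by omega)]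
    · intro i _ hi
      rw [if_neg (by omega)]
    · intro hi
      rw [Finset.mem_range, not_lt] at hi
      rw [homogeneousComponent_eq_zero _ _ (by omega)]
      simp
  · refine Finset.sum_eq_zero fun i _ => if_neg (by omega)

/-- Graded Nakayama: if some power of each homogeneous generator lies in the ideal generated by
the homogeneous `P k` of positive degree, the algebra is integral over `ℂ[P]`. -/
theorem isIntegral_of_pow_eq_sum {g : ι → MvPolynomial σ ℂ} {e : ι → ℕ}
    (hg : ∀ i, (g i).IsHomogeneous (e i)) {P : κ → MvPolynomial σ ℂ} {d : κ → ℕ}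
    (hd : ∀ k, 0 < d k) (hP : ∀ k, (P k).IsHomogeneous (d k))
    (hPB : ∀ k, P k ∈ Algebra.adjoin ℂ (Set.range g))
    (h : ∀ i, ∃ (N : ℕ) (b : κ → MvPolynomial σ ℂ),
      (∀ k, b k ∈ Algebra.adjoin ℂ (Set.range g)) ∧ g i ^ N = ∑ k, P k * b k)
    {x : MvPolynomial σ ℂ} (hx : x ∈ Algebra.adjoin ℂ (Set.range g)) :
    IsIntegral (Algebra.adjoin ℂ (Set.range P)) x := by
  classical
  set B := Algebra.adjoin ℂ (Set.range g)
  set A := Algebra.adjoin ℂ (Set.range P)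
  have hgB : ∀ i, g i ∈ B := fun i => Algebra.subset_adjoin ⟨i, rfl⟩
  choose N b hb hN using h
  set S : Submodule A (MvPolynomial σ ℂ) :=
    Submodule.span A (Set.range fun s : ∀ i, Fin (N i) => ∏ i, g i ^ (s i : ℕ))
  have hmem : ∀ n, ∀ x ∈ B, homogeneousComponent n x ∈ S := by
    intro n
    induction n using Nat.strong_induction_on with
    | _ n ih =>
    intro x hx
    refine (Submodule.span_le (p := S.restrictScalars ℂ)).2 ?_
      (homogeneousComponent_mem_span hg hx n)
    rintro _ ⟨s, hs, rfl⟩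
    change _ ∈ S
    by_cases hlt : ∀ i, s i < N i
    · exact Submodule.subset_span ⟨fun i => ⟨s i, hlt i⟩, rfl⟩
    · push Not at hlt
      obtain ⟨i, hi⟩ := hlt
      set m := g i ^ (s i - N i) * ∏ j ∈ Finset.univ.erase i, g j ^ s j
      have hm : m ∈ B := mul_mem (pow_mem (hgB i) _) (prod_mem fun j _ => pow_mem (hgB j) _)
      have hprod : ∏ j, g j ^ s j = ∑ k, P k * (b i k * m) := by
        rw [← Finset.mul_prod_erase _ _ (Finset.mem_univ i), ← Nat.add_sub_cancel' hi, pow_add, hN,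
          mul_assoc, Finset.sum_mul]
        simp only [m, mul_assoc]
      have hhom : (∏ j, g j ^ s j).IsHomogeneous n :=
        hs ▸ IsHomogeneous.prod _ _ _ fun i _ => (hg i).pow _
      have heq := homogeneousComponent_of_mem (m := n) hhom
      rw [if_pos rfl] at heq
      rw [← heq, hprod, map_sum]
      refine sum_mem fun k _ => ?_
      rw [homogeneousComponent_mul_of_isHomogeneous (hP k)]
      split_ifs with hk
      · exact S.smul_mem (⟨P k, Algebra.subset_adjoin ⟨k, rfl⟩⟩ : A)
          (ih _ (Nat.sub_lt ((hd k).trans_le hk) (hd k)) _ (mul_mem (hb i k) hm))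
      · exact zero_mem _
  have hBS : ∀ x ∈ B, x ∈ S := by
    intro x hx
    rw [← sum_homogeneousComponent x]
    exact sum_mem fun n _ => hmem n x hx
  have hSB : ∀ y ∈ S, y ∈ B := by
    intro y hy
    induction hy using Submodule.span_induction with
    | mem y hy =>
      obtain ⟨s, rfl⟩ := hy
      exact prod_mem fun j _ => pow_mem (hgB j) _
    | zero => exact zero_mem _
    | add y z _ _ hy hz => exact add_mem hy hz
    | smul a y _ hy =>
      exact mul_mem (Algebra.adjoin_le (by rintro _ ⟨k, rfl⟩; exact hPB k) a.2) hy
  refine isIntegral_of_smul_mem_submodule S ?_ (Submodule.fg_span (Set.finite_range _)) x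
    fun y hy => hBS _ (mul_mem hx (hSB y hy))
  intro hbot
  have h1 := hBS 1 (one_mem _)
  rw [hbot, Submodule.mem_bot] at h1
  exact one_ne_zero h1

end Integrality

section Parameters

/-- The basic invariants as elements of the algebra they generate. -/
noncomputable def G' (j : Fin 15) : genAlg := ⟨G j, G_mem_genAlg j⟩

/-- The parameters of degrees `3, 3, 4, 4, 4, 5`, as elements of the algebra `genAlg`. -/
noncomputable def params' : Fin 6 → genAlg :=
  ![G' 1, G' 3, G' 4 + G' 0 ^ 2, G' 5, G' 7 + G' 0 ^ 2, G' 11]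

/-- The parameters of degrees `3, 3, 4, 4, 4, 5`. -/
noncomputable def params (k : Fin 6) : Pol := params' k

theorem params_isHomogeneous (k : Fin 6) :
    (params k).IsHomogeneous (![3, 3, 4, 4, 4, 5] k) := by
  have h : ∀ j, (G' j : Pol).IsHomogeneous (gdeg j) := G_isHomogeneous
  fin_cases k <;> simp only [params, params', Fin.reduceFinMk, Matrix.cons_val,
    Subalgebra.coe_add, Subalgebra.coe_pow]
  · exact h 1
  · exact h 3
  · exact (h 4).add ((h 0).pow 2)
  · exact h 5
  · exact (h 7).add ((h 0).pow 2)
  · exact h 11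

theorem syzygies_G' : Syzygies G' := by
  obtain ⟨h1, h2, h3, h4, h5, h6, h7, h8, h9⟩ : Syzygies G := syzygies_gens ..
  exact ⟨Subtype.ext h1, Subtype.ext h2, Subtype.ext h3, Subtype.ext h4, Subtype.ext h5,
    Subtype.ext h6, Subtype.ext h7, Subtype.ext h8, Subtype.ext h9⟩

theorem G_pow_eq_sum (i : Fin 15) : ∃ (N : ℕ) (b : Fin 6 → Pol),
    (∀ k, b k ∈ genAlg) ∧ G i ^ N = ∑ k, params k * b k := by
  set J : Ideal genAlg := Ideal.span (Set.range params')
  have hrad : G' i ∈ J.radical := by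
    rw [Ideal.radical_eq_sInf, Submodule.mem_sInf]
    rintro 𝔭 ⟨hle, hprime⟩
    have : CharZero (genAlg ⧸ 𝔭) :=
      charZero_of_injective_algebraMap (algebraMap ℂ (genAlg ⧸ 𝔭)).injective
    have hk : ∀ k, Ideal.Quotient.mk 𝔭 (params' k) = 0 := fun k =>
      Ideal.Quotient.eq_zero_iff_mem.2 (hle (Ideal.subset_span ⟨k, rfl⟩))
    have h0 := hk 0
    have h1 := hk 1
    have h2 := hk 2
    have h3 := hk 3
    have h4 := hk 4
    have h5 := hk 5
    simp only [params', Matrix.cons_val, map_add, map_pow] at h0 h1 h2 h3 h4 h5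
    have hs := syzygies_G'.map (L := genAlg ⧸ 𝔭) (Ideal.Quotient.mk 𝔭)
    have hz := hs.eq_zero h0 h1 h2 h3 h4 h5 i
    exact Ideal.Quotient.eq_zero_iff_mem.1 hz
  obtain ⟨N, hN⟩ := hrad
  obtain ⟨b, hb⟩ := Ideal.mem_span_range_iff_exists_fun.1 hN
  refine ⟨N, fun k => b k, fun k => (b k).2, ?_⟩
  have h := congrArg genAlg.val hb
  rw [map_sum, map_pow] at h
  refine h.symm.trans (Finset.sum_congr rfl fun k _ => ?_)
  rw [map_mul, mul_comm]
  rfl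

theorem isIntegral_params {x : Pol} (hx : x ∈ genAlg) :
    IsIntegral (Algebra.adjoin ℂ (Set.range params)) x :=
  isIntegral_of_pow_eq_sum G_isHomogeneous
    (by decide : ∀ k, 0 < (![3, 3, 4, 4, 4, 5] : Fin 6 → ℕ) k) params_isHomogeneous (fun k => (params' k).2)
    G_pow_eq_sum hx

/-- Indices of six algebraically independent basic invariants. -/
def indepIdx : Fin 6 → Fin 15 := ![0, 1, 4, 5, 8, 12]

theorem exists_genFam_eq (y : Fin 6 → ℂ) (h1 : y 1 ≠ 0) (h2 : y 2 ≠ 0) :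
    ∃ c : Idx ![1, 2, 3] → ℂ, ∀ k, genFam c (indepIdx k) = y k := by
  set b₁ := y 4 / (2 * y 1)
  set b₂ := (y 3 + b₁ ^ 2) / (3 * y 2) with hb₂
  have e₂ : 3 * y 2 * b₂ = y 3 + b₁ ^ 2 := by rw [hb₂]; field_simp
  set b₃ := ((y 5 + 2 * b₁ * y 3) / (3 * y 2) + b₁ * b₂) / (9 * y 2) with hb₃
  have e₃ : 3 * y 2 * (9 * y 2 * b₃ - b₁ * b₂) = y 5 + 2 * b₁ * y 3 := by
    rw [hb₃]; field_simp; ring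
  have e₁ : 2 * y 1 * b₁ = y 4 := by simp only [b₁]; field_simp
  refine ⟨tup 0 1 (y 1) 0 (-y 0 / (4 * y 1)) (y 2) b₁ b₂ b₃, fun k => ?_⟩
  rw [genFam_tup]
  fin_cases k <;>
  simp only [indepIdx, gens, gensOf, Fin.reduceFinMk, Matrix.cons_val, qe, qb, ce, cp, hes₀, hes₁,
    hes₂, lin₀, lin₁]
  · field_simp
    ring
  · ring
  · ring
  · linear_combination e₂
  · linear_combination e₁
  · linear_combination e₃ - 2 * b₁ * e₂

theorem algebraicIndependent_of_exists_aeval_eq {σ ι : Type*} {Q : ι → MvPolynomial σ ℂ}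
    {D : MvPolynomial ι ℂ} (hD : D ≠ 0)
    (h : ∀ y, eval y D ≠ 0 → ∃ c : σ → ℂ, ∀ k, aeval c (Q k) = y k) :
    AlgebraicIndependent ℂ Q := by
  rw [algebraicIndependent_iff]
  intro F hF
  refine (mul_eq_zero.1 (MvPolynomial.funext fun y => ?_ : F * D = 0)).resolve_right hD
  rw [map_mul, map_zero]
  by_cases hy : eval y D = 0
  · rw [hy, mul_zero]
  · obtain ⟨c, hc⟩ := h y hy
    have h3 := congrArg (aeval c) hF
    rw [← AlgHom.comp_apply, comp_aeval, map_zero, funext hc] at h3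
    have h4 : eval y F = 0 := h3
    rw [h4, zero_mul]

theorem algebraicIndependent_indepIdx :
    AlgebraicIndependent ℂ fun k => G' (indepIdx k) := by
  refine AlgebraicIndependent.of_comp genAlg.val
    (algebraicIndependent_of_exists_aeval_eq (D := X 1 * X 2)
      (mul_ne_zero (X_ne_zero _) (X_ne_zero _)) fun y hy => ?_)
  rw [map_mul, eval_X, eval_X] at hy
  obtain ⟨c, hc⟩ := exists_genFam_eq y (left_ne_zero_of_mul hy) (right_ne_zero_of_mul hy)
  exact ⟨c, fun k => (aeval_G c _).trans (hc k)⟩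

theorem algebraicIndependent_params : AlgebraicIndependent ℂ params := by
  have halg : Algebra.IsAlgebraic (Algebra.adjoin ℂ (Set.range params')) genAlg := by
    refine ⟨fun y => ?_⟩
    have hmap : (Algebra.adjoin ℂ (Set.range params')).map genAlg.val =
        Algebra.adjoin ℂ (Set.range params) := by
      rw [AlgHom.map_adjoin, ← Set.range_comp]
      rfl
    obtain ⟨p, hp, hy⟩ := hmap ▸ isIntegral_params y.2
    set e := (Algebra.adjoin ℂ (Set.range params')).equivMapOfInjective genAlg.val
      Subtype.val_injective
    refine IsIntegral.isAlgebraic ⟨p.map (e.symm : _ →+* _), hp.map _, Subtype.val_injective ?_⟩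
    change genAlg.val _ = genAlg.val 0
    rw [map_zero, ← hy, Polynomial.eval₂_map]
    refine (Polynomial.hom_eval₂ p _ (genAlg.val : _ →+* Pol) y).trans ?_
    congr 1
    refine RingHom.ext fun a => ?_
    exact congrArg Subtype.val (e.apply_symm_apply a)
  have hle : Cardinal.mk (Fin 6) ≤ Algebra.trdeg ℂ genAlg :=
    algebraicIndependent_indepIdx.cardinalMk_le_trdeg
  have hx := (Algebra.IsAlgebraic.isTranscendenceBasis_of_le_trdeg_of_finite ℂ params' hle).1
  exact hx.map' (f := genAlg.val) Subtype.val_injective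

theorem isHSOP_params : IsHSOP ![1, 2, 3] params ![3, 3, 4, 4, 4, 5] :=
  ⟨fun k => invariantRing_eq ▸ (params' k).2, by decide, params_isHomogeneous,
    algebraicIndependent_params, fun _ hx => isIntegral_params (invariantRing_eq ▸ hx)⟩

end Parameters

section NoParameters

theorem eval_eq_zero_of_isIntegral {σ κ : Type*} {P : κ → MvPolynomial σ ℂ} {d : κ → ℕ}
    (hP : ∀ k, (P k).IsHomogeneous (d k)) {x : MvPolynomial σ ℂ} {e : ℕ}
    (he : 0 < e) (hx : x.IsHomogeneous e)
    (hx_int : IsIntegral (Algebra.adjoin ℂ (Set.range P)) x) {c : σ → ℂ}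
    (hc : ∀ k, eval c (P k) = 0) : eval c x = 0 := by
  by_contra hne
  obtain ⟨p, hp, hpx⟩ := hx_int
  set φ : ℂ → Algebra.adjoin ℂ (Set.range P) →+* ℂ := fun t =>
    (eval fun i => t * c i).comp (algebraMap _ _)
  have hφ : ∀ t, φ t = φ 0 := by
    intro t
    refine RingHom.ext fun ⟨a, ha⟩ => ?_
    change eval _ a = eval _ a
    induction ha using Algebra.adjoin_induction with
    | mem a ha =>
      obtain ⟨k, rfl⟩ := ha
      rw [eval_smul_of_isHomogeneous (hP k), eval_smul_of_isHomogeneous (hP k), hc, mul_zero,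
        mul_zero]
    | algebraMap r => rw [algebraMap_eq, eval_C, eval_C]
    | add a b _ _ ha hb => rw [map_add, map_add, ha, hb]
    | mul a b _ _ ha hb => rw [map_mul, map_mul, ha, hb]
  have hroot : p.map (φ 0) = 0 := by
    refine Polynomial.funext fun z => ?_
    obtain ⟨t, ht⟩ := IsAlgClosed.exists_pow_nat_eq (z / eval c x) he
    have h := congrArg (eval fun i => t * c i) hpx
    rw [Polynomial.hom_eval₂, eval_smul_of_isHomogeneous hx, ht, div_mul_cancel₀ _ hne,
      map_zero] at h
    rw [Polynomial.eval_map, ← hφ t, Polynomial.eval_zero]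
    exact h
  exact (hp.map _).ne_zero hroot

variable {c : Idx ![1, 2, 3] → ℂ}

/-- All basic invariants vanish at `c` except possibly those depending only on the linear and the
cubic form. -/
def QuadFree (c : Idx ![1, 2, 3] → ℂ) : Prop :=
  ∀ j, j ≠ 4 → j ≠ 5 → j ≠ 7 → j ≠ 12 → genFam c j = 0

theorem quadFree_tup (l₀ l₁ b₀ b₁ b₂ b₃ : ℂ) : QuadFree (tup l₀ l₁ 0 0 0 b₀ b₁ b₂ b₃) := by
  intro j h4 h5 h7 h12
  rw [genFam_tup]
  fin_cases j <;> first
    | exact absurd rfl h4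
    | exact absurd rfl h5
    | exact absurd rfl h7
    | exact absurd rfl h12
    | simp [gens, gensOf, qe, qb, lin₀, lin₁]

theorem eval_prod_G (s : Fin 15 → ℕ) : eval c (∏ j, G j ^ s j) = ∏ j, genFam c j ^ s j := by
  rw [map_prod]
  exact Finset.prod_congr rfl fun j _ => by rw [map_pow, eval_G]

theorem QuadFree.eval_prod (s : Fin 15 → ℕ) :
    (∀ c, QuadFree c → eval c (∏ j, G j ^ s j) = 0) ∨
      (∑ j, gdeg j * s j = 4 * (s 4 + s 5 + s 7) + 6 * s 12 ∧ ∀ c, eval c (∏ j, G j ^ s j) =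
        genFam c 4 ^ s 4 * genFam c 5 ^ s 5 * genFam c 7 ^ s 7 * genFam c 12 ^ s 12) := by
  simp only [eval_prod_G]
  by_cases h : ∀ j, j ≠ 4 → j ≠ 5 → j ≠ 7 → j ≠ 12 → s j = 0
  · right
    have h0 := h 0 (by decide) (by decide) (by decide) (by decide)
    have h1 := h 1 (by decide) (by decide) (by decide) (by decide)
    have h2 := h 2 (by decide) (by decide) (by decide) (by decide)
    have h3 := h 3 (by decide) (by decide) (by decide) (by decide)
    have h6 := h 6 (by decide) (by decide) (by decide) (by decide)
    have h8 := h 8 (by decide) (by decide) (by decide) (by decide)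
    have h9 := h 9 (by decide) (by decide) (by decide) (by decide)
    have h10 := h 10 (by decide) (by decide) (by decide) (by decide)
    have h11 := h 11 (by decide) (by decide) (by decide) (by decide)
    have h13 := h 13 (by decide) (by decide) (by decide) (by decide)
    have h14 := h 14 (by decide) (by decide) (by decide) (by decide)
    have hs : s = ![0, 0, 0, 0, s 4, s 5, 0, s 7, 0, 0, 0, 0, s 12, 0, 0] := by
      funext j
      fin_cases j <;> first | assumption | rfl
    generalize s 4 = p at hs ⊢
    generalize s 5 = q at hs ⊢
    generalize s 7 = r at hs ⊢
    generalize s 12 = t at hs ⊢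
    subst hs
    constructor
    · simp [Fin.sum_univ_succ, gdeg]
      ring
    · simp [Fin.prod_univ_succ, mul_assoc]
  · left
    push Not at h
    obtain ⟨j, h4, h5, h7, h12, hj⟩ := h
    intro c hc
    exact Finset.prod_eq_zero (Finset.mem_univ j) (by rw [hc j h4 h5 h7 h12, zero_pow hj])

theorem mem_span_of_isHomogeneous {x : Pol} (hx : x ∈ invariantRing ![1, 2, 3]) {d : ℕ}
    (hd : x.IsHomogeneous d) : x ∈ Submodule.span ℂ
      {y | ∃ s : Fin 15 → ℕ, ∑ j, gdeg j * s j = d ∧ y = ∏ j, G j ^ s j} := by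
  have h := homogeneousComponent_mem_span G_isHomogeneous (invariantRing_eq ▸ hx) d
  rwa [homogeneousComponent_of_mem hd, if_pos rfl] at h

theorem QuadFree.eval_eq_zero (hc : QuadFree c) {x : Pol} (hx : x ∈ invariantRing ![1, 2, 3])
    {d : ℕ} (hd : x.IsHomogeneous d) (hd' : d = 2 ∨ d = 3 ∨ d = 5) : eval c x = 0 := by
  have h := mem_span_of_isHomogeneous hx hd
  clear hx hd
  induction h using Submodule.span_induction with
  | mem y hy =>
    obtain ⟨s, hs, rfl⟩ := hy
    rcases QuadFree.eval_prod s with h | ⟨h, -⟩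
    · exact h c hc
    · omega
  | zero => exact map_zero _
  | add y z _ _ hy hz => rw [map_add, hy, hz, add_zero]
  | smul r y _ hy => rw [smul_eval, hy, mul_zero]

theorem exists_eval_eq {x : Pol} (hx : x ∈ invariantRing ![1, 2, 3]) (hd : x.IsHomogeneous 4) :
    ∃ w : Fin 3 → ℂ, ∀ c, QuadFree c →
      eval c x = w 0 * genFam c 4 + w 1 * genFam c 5 + w 2 * genFam c 7 := by
  have h := mem_span_of_isHomogeneous hx hd
  clear hx hd
  induction h using Submodule.span_induction with
  | mem y hy =>
    obtain ⟨s, hs, rfl⟩ := hy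
    rcases QuadFree.eval_prod s with h | ⟨hsum, h⟩
    · exact ⟨0, fun c hc => by simp [h c hc]⟩
    · refine ⟨![s 4, s 5, s 7], fun c _ => ?_⟩
      have : s 12 = 0 ∧ (s 4 = 1 ∧ s 5 = 0 ∧ s 7 = 0 ∨ s 4 = 0 ∧ s 5 = 1 ∧ s 7 = 0 ∨
          s 4 = 0 ∧ s 5 = 0 ∧ s 7 = 1) := by omega
      obtain ⟨h12, ⟨h4, h5, h7⟩ | ⟨h4, h5, h7⟩ | ⟨h4, h5, h7⟩⟩ := this <;>
      simp [h, h4, h5, h7, h12]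
  | zero => exact ⟨0, fun c _ => by simp⟩
  | add y z _ _ hy hz =>
    obtain ⟨v, hv⟩ := hy
    obtain ⟨w, hw⟩ := hz
    refine ⟨v + w, fun c hc => ?_⟩
    rw [map_add, hv c hc, hw c hc, Pi.add_apply, Pi.add_apply, Pi.add_apply]
    ring
  | smul r y _ hy =>
    obtain ⟨w, hw⟩ := hy
    refine ⟨r • w, fun c hc => ?_⟩
    rw [smul_eval, hw c hc]
    simp only [Pi.smul_apply, smul_eq_mul]
    ring

theorem exists_quadFree (y : Fin 3 → ℂ) : ∃ c, QuadFree c ∧ genFam c 4 = y 0 ∧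
    genFam c 5 = y 1 ∧ genFam c 7 = y 2 := by
  by_cases h0 : y 0 = 0
  · by_cases h1 : y 1 = 0
    · obtain ⟨r, hr⟩ := IsAlgClosed.exists_pow_nat_eq (y 2) two_pos
      refine ⟨_, quadFree_tup 0 0 1 0 0 (r / 9), ?_⟩
      simp only [genFam_tup, gens, gensOf, Matrix.cons_val, qe, ce, hes₀, hes₁, hes₂, h0, h1]
      refine ⟨by ring, by ring, ?_⟩
      rw [← hr]
      ring
    · obtain ⟨r, hr⟩ := IsAlgClosed.exists_pow_nat_eq (-y 1) two_pos
      have hr0 : r ≠ 0 := by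
        rintro rfl
        exact h1 (by simpa using hr.symm)
      refine ⟨_, quadFree_tup 0 1 0 r 0 (-y 2 / (12 * y 1 * r)), ?_⟩
      simp only [genFam_tup, gens, gensOf, Matrix.cons_val, qe, ce, hes₀, hes₁, hes₂, h0]
      have e : 12 * y 1 * r * (-y 2 / (12 * y 1 * r)) = -y 2 := by field_simp
      refine ⟨by ring, by linear_combination -hr, ?_⟩
      linear_combination 12 * r * (-y 2 / (12 * y 1 * r)) * hr - e
  · obtain ⟨r, hr⟩ := IsAlgClosed.exists_pow_nat_eq (y 2 - 4 * y 1 * (y 1 / (3 * y 0)) ^ 2) two_pos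
    refine ⟨_, quadFree_tup 0 1 (y 0) 0 (y 1 / (3 * y 0)) (r / (9 * y 0)), ?_⟩
    simp only [genFam_tup, gens, gensOf, Matrix.cons_val, qe, ce, hes₀, hes₁, hes₂]
    have e : 9 * y 0 * (r / (9 * y 0)) = r := by field_simp
    have e' : 3 * y 0 * (y 1 / (3 * y 0)) = y 1 := by field_simp
    refine ⟨by ring, by linear_combination e', ?_⟩
    rw [e, e']
    linear_combination hr

theorem not_exists_isHSOP : ¬ ∃ P : Fin 6 → MvPolynomial (Idx ![1, 2, 3]) ℂ,
    IsHSOP ![1, 2, 3] P ![2, 3, 3, 4, 4, 5] := by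
  rintro ⟨P, hmem, -, hhom, -, hx_int⟩
  obtain ⟨v, hv⟩ := exists_eval_eq (hmem 3) (hhom 3)
  obtain ⟨w, hw⟩ := exists_eval_eq (hmem 4) (hhom 4)
  obtain ⟨y, hy, hy0⟩ := Submodule.exists_mem_ne_zero_of_ne_bot
    (LinearMap.ker_ne_bot_of_finrank_lt (K := ℂ) (f := (Matrix.of ![v, w]).mulVecLin) (by simp))
  obtain ⟨c, hc, h4, h5, h7⟩ := exists_quadFree y
  have hy := fun i => congrFun (LinearMap.mem_ker.1 hy) i
  have hP : ∀ k, eval c (P k) = 0 := by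
    intro k
    fin_cases k
    · exact hc.eval_eq_zero (hmem 0) (hhom 0) (by decide)
    · exact hc.eval_eq_zero (hmem 1) (hhom 1) (by decide)
    · exact hc.eval_eq_zero (hmem 2) (hhom 2) (by decide)
    · refine (hv c hc).trans ?_
      rw [h4, h5, h7]
      simpa [Matrix.mulVec, dotProduct, Fin.sum_univ_succ, add_assoc] using hy 0
    · refine (hw c hc).trans ?_
      rw [h4, h5, h7]
      simpa [Matrix.mulVec, dotProduct, Fin.sum_univ_succ, add_assoc] using hy 1
    · exact hc.eval_eq_zero (hmem 5) (hhom 5) (by decide)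
  have hG : ∀ j, 0 < gdeg j → genFam c j = 0 := fun j hj =>
    (eval_G c j).symm.trans
      (eval_eq_zero_of_isIntegral hhom hj (G_isHomogeneous j) (hx_int _ (G_mem j)) hP)
  refine hy0 (funext fun i => ?_)
  fin_cases i
  · exact h4.symm.trans (hG 4 (by decide))
  · exact h5.symm.trans (hG 5 (by decide))
  · exact h7.symm.trans (hG 7 (by decide))

end NoParameters

end BinInv

open BinInv in
/-- For `V = V₁ ⊕ V₂ ⊕ V₃`: there is a homogeneous system of parameters of degrees
`3, 3, 4, 4, 4, 5`; the minimal number of generators is `15`, with degrees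
`2, 3, 3, 3, 4, 4, 4, 4, 5, 5, 5, 5, 6, 6, 7`; and there is no homogeneous system of
parameters of degrees `2, 3, 3, 4, 4, 5`. -/
theorem V1_V2_V3_hsop_and_generators :
    (∃ P : Fin 6 → MvPolynomial (Idx ![1, 2, 3]) ℂ,
      IsHSOP ![1, 2, 3] P ![3, 3, 4, 4, 4, 5]) ∧
    HasMinimalGens ![1, 2, 3]
      ![2, 3, 3, 3, 4, 4, 4, 4, 5, 5, 5, 5, 6, 6, 7] ∧
    ¬ ∃ P : Fin 6 → MvPolynomial (Idx ![1, 2, 3]) ℂ,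
      IsHSOP ![1, 2, 3] P ![2, 3, 3, 4, 4, 5] := by
  exact ⟨⟨params, isHSOP_params⟩, hasMinimalGens, not_exists_isHSOP⟩
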